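/- arXiv:2402.12909 — 2 statements merged into one kernel-verified Lean document; each statement's English description precedes it below -/
import Mathlib

section
/- Let P be a compact property for holomorphic maps into the Riemann sphere. If f ∈ 𝒫(𝔻 \ {0}), where 𝔻 is the open unit disk, then z = 0 is not an essential singularity of f; that is, f extends to a holomorphic map from 𝔻 to the Riemann sphere Ĉ. -/
open Filter Set MeasureTheory Topology
open scoped ENNReal

noncomputable section

/-- Half of the chordal (spherical) distance on the Riemann sphere `OnePoint ℂ`. -/
def sphDist : OnePoint ℂ → OnePoint ℂ → ℝ
  | OnePoint.infty, OnePoint.infty => 0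
  | OnePoint.infty, (w : ℂ) => 1 / Real.sqrt (1 + ‖w‖ ^ 2)
  | (z : ℂ), OnePoint.infty => 1 / Real.sqrt (1 + ‖z‖ ^ 2)
  | (z : ℂ), (w : ℂ) => ‖z - w‖ / (Real.sqrt (1 + ‖z‖ ^ 2) * Real.sqrt (1 + ‖w‖ ^ 2))

/-- A map `f : ℂ → Ĉ` is holomorphic on `U` if near each point of `U` it is, in the chart,
either a coerced holomorphic function or the reciprocal of a holomorphic function. -/
def SphHolomorphicOn (f : ℂ → OnePoint ℂ) (U : Set ℂ) : Prop :=
  ∀ z ∈ U, ∃ V : Set ℂ, IsOpen V ∧ z ∈ V ∧ ∃ h : ℂ → ℂ, DifferentiableOn ℂ h V ∧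
    ((∀ w ∈ V, f w = (h w : OnePoint ℂ)) ∨
     (∀ w ∈ V, f w = if h w = 0 then OnePoint.infty else (((h w)⁻¹ : ℂ) : OnePoint ℂ)))

/-- Locally uniform convergence on `U` with respect to the spherical distance. -/
def SphLocUnifOn (F : ℕ → ℂ → OnePoint ℂ) (f : ℂ → OnePoint ℂ) (U : Set ℂ) : Prop :=
  ∀ K : Set ℂ, K ⊆ U → IsCompact K → ∀ ε > (0:ℝ),
    ∀ᶠ n in Filter.atTop, ∀ z ∈ K, sphDist (F n z) (f z) < ε

/-- Locally uniform convergence of real-valued functions on `U`. -/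
def RealLocUnifOn (F : ℕ → ℂ → ℝ) (f : ℂ → ℝ) (U : Set ℂ) : Prop :=
  ∀ K : Set ℂ, K ⊆ U → IsCompact K → ∀ ε > (0:ℝ),
    ∀ᶠ n in Filter.atTop, ∀ z ∈ K, |F n z - f z| < ε

/-- A closed property for holomorphic maps into the Riemann sphere (on plane domains). -/
structure IsClosedProperty (P : Set ℂ → (ℂ → OnePoint ℂ) → Prop) : Prop where
  mem_holo : ∀ (U : Set ℂ) (f : ℂ → OnePoint ℂ), IsOpen U → IsConnected U →
    P U f → SphHolomorphicOn f U
  /-- (P1): stability under precomposition with unramified holomorphic maps. -/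
  comp : ∀ (U V : Set ℂ) (φ : ℂ → ℂ) (f : ℂ → OnePoint ℂ),
    IsOpen U → IsConnected U → IsOpen V → IsConnected V →
    DifferentiableOn ℂ φ U → Set.MapsTo φ U V → (∀ z ∈ U, deriv φ z ≠ 0) →
    P V f → P U (f ∘ φ)
  /-- (P2): if `f` has the property on every relatively compact subdomain, it has it globally. -/
  exhaust : ∀ (U : Set ℂ) (f : ℂ → OnePoint ℂ), IsOpen U → IsConnected U →
    SphHolomorphicOn f U →
    (∀ Ω : Set ℂ, IsOpen Ω → IsConnected Ω → IsCompact (closure Ω) → closure Ω ⊆ U → P Ω f) →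
    P U f
  /-- (P3): `𝒫(U)` is closed under locally uniform spherical convergence in `𝑀(U)`. -/
  closed : ∀ (U : Set ℂ) (f : ℂ → OnePoint ℂ) (F : ℕ → ℂ → OnePoint ℂ),
    IsOpen U → IsConnected U → (∀ n, P U (F n)) → SphLocUnifOn F f U →
    SphHolomorphicOn f U → P U f

/-- A compact property: a closed property all of whose families `𝒫(U)` are normal. -/
structure IsCompactProperty (P : Set ℂ → (ℂ → OnePoint ℂ) → Prop) extends
    IsClosedProperty P : Prop where
  /-- (P4): normality of `𝒫(U)` for every domain `U`. -/
  normal : ∀ (U : Set ℂ), IsOpen U → IsConnected U →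
    ∀ F : ℕ → ℂ → OnePoint ℂ, (∀ n, P U (F n)) →
      ∃ φ : ℕ → ℕ, StrictMono φ ∧ ∃ g : ℂ → OnePoint ℂ, SphLocUnifOn (F ∘ φ) g U

/-- The spherical derivative of a map into the Riemann sphere (limit of spherical
difference quotients). For `f` meromorphic near `z` this equals `|f'|/(1+|f|²)`. -/
def sphD (f : ℂ → OnePoint ℂ) (z : ℂ) : ℝ :=
  limUnder (𝓝[≠] z) (fun w => sphDist (f w) (f z) / ‖w - z‖)

/-- A Weierstrass `m`-triple on a plane domain `U`: a holomorphic `1`-form `f dz`, a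
meromorphic function `g`, and the (continuous positive) conformal density `lam` of the
metric `ds² = (1+|g|²)^m |f|² |dz|²`. -/
structure WeierstrassTriple (m : ℕ) (U : Set ℂ) where
  isOpen : IsOpen U
  isConnected : IsConnected U
  f : ℂ → ℂ
  g : ℂ → OnePoint ℂ
  f_holo : DifferentiableOn ℂ f U
  g_holo : SphHolomorphicOn g U
  g_mero : ∃ z ∈ U, g z ≠ OnePoint.infty
  lam : ℂ → ℝ
  lam_cont : ContinuousOn lam U
  lam_pos : ∀ z ∈ U, 0 < lam z
  lam_eq : ∀ z ∈ U, ∀ w : ℂ, g z = (w : OnePoint ℂ) →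
    lam z = (1 + ‖w‖ ^ 2) ^ ((m : ℝ) / 2) * ‖f z‖

/-- The Gaussian curvature `K = -2m |g'|²/((1+|g|²)^{m+2}|f|²)` of a Weierstrass
`m`-triple, written via the spherical derivative: `K = -2m (g^#)² / λ²`. -/
def WeierstrassTriple.curv {m : ℕ} {U : Set ℂ} (T : WeierstrassTriple m U) (z : ℂ) : ℝ :=
  -(2 * m) * (sphD T.g z) ^ 2 / (T.lam z) ^ 2

/-- A divergent `C¹` path in `U` starting at `p`, parametrized by `[0,1)`. -/
structure DivergentPath (U : Set ℂ) (p : ℂ) where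
  toFun : ℝ → ℂ
  start : toFun 0 = p
  mem : ∀ t ∈ Set.Ico (0:ℝ) 1, toFun t ∈ U
  cont : ContinuousOn toFun (Set.Ico (0:ℝ) 1)
  diff : ∀ t ∈ Set.Ioo (0:ℝ) 1, DifferentiableAt ℝ toFun t
  divergent : ∀ K : Set ℂ, IsCompact K → K ⊆ U →
    ∃ t₀ ∈ Set.Ico (0:ℝ) 1, ∀ t, t₀ ≤ t → t < 1 → toFun t ∉ K

/-- The length of a path with respect to the conformal metric with density `lam`. -/
def pathLen (lam : ℂ → ℝ) (γ : ℝ → ℂ) : ℝ≥0∞ :=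
  ∫⁻ t in Set.Ioo (0:ℝ) 1, ENNReal.ofReal (lam (γ t) * ‖deriv γ t‖)

/-- The geodesic distance from `p` to the boundary of `U`: the infimum of lengths of
divergent paths starting at `p`. -/
def distToBdry (lam : ℂ → ℝ) (U : Set ℂ) (p : ℂ) : ℝ≥0∞ :=
  ⨅ γ : DivergentPath U p, pathLen lam γ.toFun

/-- Completeness of the conformal metric with density `lam` on `U`: every divergent path
has infinite length. -/
def IsCompleteMetric (lam : ℂ → ℝ) (U : Set ℂ) : Prop :=
  ∀ p ∈ U, ∀ γ : DivergentPath U p, pathLen lam γ.toFun = ⊤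

/-- The property `P_L`: `|f| < L` on `U`, or `f` is constant on `U`. -/
def PL (L : ℝ) (U : Set ℂ) (f : ℂ → OnePoint ℂ) : Prop :=
  SphHolomorphicOn f U ∧
    ((∀ z ∈ U, ∃ w : ℂ, f z = (w : OnePoint ℂ) ∧ ‖w‖ < L) ∨
      (∀ z ∈ U, ∀ w ∈ U, f z = f w))

/-- The property `P_X`: `f` omits every value of `X`, or `f` is constant on `U`. -/
def PX (X : Set (OnePoint ℂ)) (U : Set ℂ) (f : ℂ → OnePoint ℂ) : Prop :=
  SphHolomorphicOn f U ∧ ((∀ z ∈ U, f z ∉ X) ∨ (∀ z ∈ U, ∀ w ∈ U, f z = f w))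

/-- Second directional derivative of `u : ℂ → ℝ` at `z` in direction `v`. -/
def dirDeriv2 (u : ℂ → ℝ) (z v : ℂ) : ℝ :=
  deriv (deriv (fun t : ℝ => u (z + t • v))) 0

/-- The Euclidean Laplacian of `u : ℂ → ℝ`. -/
def laplacian (u : ℂ → ℝ) (z : ℂ) : ℝ :=
  dirDeriv2 u z 1 + dirDeriv2 u z Complex.I


/-- A compact property `P` satisfies the `m`-curvature estimate if there is `C > 0` such
that `|K| d² ≤ C` for every Weierstrass `m`-triple whose meromorphic function satisfies `P`. -/
def SatisfiesCurvatureEstimate (P : Set ℂ → (ℂ → OnePoint ℂ) → Prop) (m : ℕ) : Prop :=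
  ∃ C : ℝ, 0 < C ∧ ∀ (U : Set ℂ) (T : WeierstrassTriple m U), P U T.g →
    ∀ p ∈ U, ENNReal.ofReal |T.curv p| * (distToBdry T.lam U p) ^ 2 ≤ ENNReal.ofReal C

/-- Stereographic projection of the Riemann sphere onto a Euclidean sphere of radius `1/2`. -/
def stereo (p : OnePoint ℂ) : WithLp 2 (ℂ × ℝ) :=
  p.elim 0 fun z => WithLp.toLp 2 (z / ((1 + ‖z‖ ^ 2 : ℝ) : ℂ), 1 / (1 + ‖z‖ ^ 2))

/-- The height of a point of the Riemann sphere: `1 / (1 + |z|²)` at `z`, and `0` at infinity. -/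
def sphHeight (p : OnePoint ℂ) : ℝ := (stereo p).snd

/-- The inversion `z ↦ 1 / z` of the Riemann sphere. -/
def sphInv (p : OnePoint ℂ) : OnePoint ℂ :=
  p.elim ((0 : ℂ) : OnePoint ℂ) fun z =>
    if z = 0 then OnePoint.infty else ((z⁻¹ : ℂ) : OnePoint ℂ)

/-- The finite part of a point of the Riemann sphere, with `∞ ↦ 0`. -/
def sphFin (p : OnePoint ℂ) : ℂ := p.elim 0 id

lemma stereo_infty : stereo OnePoint.infty = 0 := rfl

lemma stereo_coe (z : ℂ) : stereo (z : OnePoint ℂ) =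
    WithLp.toLp 2 (z / ((1 + ‖z‖ ^ 2 : ℝ) : ℂ), 1 / (1 + ‖z‖ ^ 2)) := rfl

lemma sphHeight_coe (z : ℂ) : sphHeight (z : OnePoint ℂ) = 1 / (1 + ‖z‖ ^ 2) := rfl

lemma sphHeight_infty : sphHeight OnePoint.infty = 0 := rfl

lemma sphFin_coe (z : ℂ) : sphFin (z : OnePoint ℂ) = z := rfl

lemma norm_stereo_coe_sq (z : ℂ) : ‖stereo (z : OnePoint ℂ)‖ ^ 2 = 1 / (1 + ‖z‖ ^ 2) := by
  have h : (0 : ℝ) < 1 + ‖z‖ ^ 2 := by positivity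
  rw [stereo_coe, WithLp.prod_norm_sq_eq_of_L2]
  simp only [WithLp.toLp_fst, WithLp.toLp_snd, norm_div, Complex.norm_real,
    Real.norm_of_nonneg h.le, norm_one]
  field_simp
  ring

lemma norm_stereo_sub_coe_sq (z w : ℂ) :
    ‖stereo (z : OnePoint ℂ) - stereo (w : OnePoint ℂ)‖ ^ 2 =
      ‖z - w‖ ^ 2 / ((1 + ‖z‖ ^ 2) * (1 + ‖w‖ ^ 2)) := by
  have hz : (0 : ℝ) < 1 + ‖z‖ ^ 2 := by positivity
  have hw : (0 : ℝ) < 1 + ‖w‖ ^ 2 := by positivity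
  rw [stereo_coe, stereo_coe, WithLp.prod_norm_sq_eq_of_L2]
  simp only [WithLp.sub_fst, WithLp.sub_snd, WithLp.toLp_fst, WithLp.toLp_snd, Real.norm_eq_abs,
    sq_abs]
  have e : z / ((1 + ‖z‖ ^ 2 : ℝ) : ℂ) - w / ((1 + ‖w‖ ^ 2 : ℝ) : ℂ) =
      ((1 + ‖w‖ ^ 2 : ℝ) * z - (1 + ‖z‖ ^ 2 : ℝ) * w) /
        (((1 + ‖z‖ ^ 2) * (1 + ‖w‖ ^ 2) : ℝ) : ℂ) := by
    have hz' : ((1 + ‖z‖ ^ 2 : ℝ) : ℂ) ≠ 0 := by exact_mod_cast hz.ne'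
    have hw' : ((1 + ‖w‖ ^ 2 : ℝ) : ℂ) ≠ 0 := by exact_mod_cast hw.ne'
    rw [Complex.ofReal_mul]
    field_simp
  rw [e, norm_div, Complex.norm_real, Real.norm_of_nonneg (by positivity), div_pow]
  have e2 : ‖((1 + ‖w‖ ^ 2 : ℝ) : ℂ) * z - ((1 + ‖z‖ ^ 2 : ℝ) : ℂ) * w‖ ^ 2 =
      (1 + ‖w‖ ^ 2) * (1 + ‖z‖ ^ 2) * ‖z - w‖ ^ 2 - (‖z‖ ^ 2 - ‖w‖ ^ 2) ^ 2 := by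
    simp only [Complex.sq_norm, Complex.normSq_apply, Complex.sub_re, Complex.sub_im,
      Complex.re_ofReal_mul, Complex.im_ofReal_mul]
    ring
  rw [e2]
  field_simp
  ring

lemma sphDist_eq_dist_stereo (p q : OnePoint ℂ) : sphDist p q = dist (stereo p) (stereo q) := by
  have key : ∀ {a b : ℝ}, 0 ≤ a → 0 ≤ b → a ^ 2 = b ^ 2 → a = b := fun ha hb h =>
    (sq_eq_sq₀ ha hb).1 h
  rw [dist_eq_norm]
  induction p using OnePoint.rec with
  | infty =>
    induction q using OnePoint.rec with
    | infty => simp [sphDist]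
    | coe w =>
      refine key (by simp only [sphDist]; positivity) (norm_nonneg _) ?_
      rw [stereo_infty, zero_sub, norm_neg, norm_stereo_coe_sq]
      simp only [sphDist]
      rw [div_pow, Real.sq_sqrt (by positivity), one_pow]
  | coe z =>
    induction q using OnePoint.rec with
    | infty =>
      refine key (by simp only [sphDist]; positivity) (norm_nonneg _) ?_
      rw [stereo_infty, sub_zero, norm_stereo_coe_sq]
      simp only [sphDist]
      rw [div_pow, Real.sq_sqrt (by positivity), one_pow]
    | coe w =>
      refine key (by simp only [sphDist]; positivity) (norm_nonneg _) ?_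
      rw [norm_stereo_sub_coe_sq]
      simp only [sphDist]
      rw [div_pow, mul_pow, Real.sq_sqrt (by positivity), Real.sq_sqrt (by positivity)]

lemma sphInv_sphInv (p : OnePoint ℂ) : sphInv (sphInv p) = p := by
  induction p using OnePoint.rec with
  | infty => simp [sphInv]
  | coe z => by_cases h : z = 0 <;> simp [sphInv, h]

lemma stereo_sphInv (p : OnePoint ℂ) : stereo (sphInv p) =
    WithLp.toLp 2 (starRingEnd ℂ (stereo p).fst, 1 - (stereo p).snd) := by
  induction p using OnePoint.rec with
  | infty => simp [sphInv, stereo]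
  | coe z =>
    by_cases h : z = 0
    · simp [sphInv, stereo, h]
      rfl
    · have hz : ‖z‖ ≠ 0 := norm_ne_zero_iff.2 h
      have hz1 : (1 + (‖z‖ : ℂ) ^ 2) ≠ 0 := by
        have : (1 + ‖z‖ ^ 2 : ℝ) ≠ 0 := by positivity
        exact_mod_cast this
      have hc : (‖z‖ : ℂ) ^ 2 = starRingEnd ℂ z * z := by
        rw [mul_comm, Complex.mul_conj, Complex.normSq_eq_norm_sq]; push_cast; rfl
      have hcz : (‖z‖ : ℂ) ≠ 0 := by exact_mod_cast hz
      have e : sphInv (z : OnePoint ℂ) = ((z⁻¹ : ℂ) : OnePoint ℂ) := by simp [sphInv, h]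
      rw [e, stereo_coe, stereo_coe]
      congr 2
      · simp only [WithLp.toLp_fst, norm_inv, map_div₀, Complex.conj_ofReal]
        push_cast
        have h2 : (1 + ((‖z‖ : ℂ)⁻¹) ^ 2) = (1 + (‖z‖ : ℂ) ^ 2) / (‖z‖ : ℂ) ^ 2 := by
          field_simp
          ring
        rw [h2, div_div_eq_mul_div, hc]
        rw [hc] at hz1
        field_simp
      · simp only [WithLp.toLp_snd, norm_inv]
        field_simp
        ring

lemma sphDist_sphInv (p q : OnePoint ℂ) : sphDist (sphInv p) (sphInv q) = sphDist p q := by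
  simp only [sphDist_eq_dist_stereo, stereo_sphInv, dist_eq_norm]
  refine (sq_eq_sq₀ (norm_nonneg _) (norm_nonneg _)).1 ?_
  rw [WithLp.prod_norm_sq_eq_of_L2, WithLp.prod_norm_sq_eq_of_L2]
  simp only [WithLp.sub_fst, WithLp.sub_snd, WithLp.toLp_fst, WithLp.toLp_snd, ← map_sub,
    RCLike.norm_conj, Real.norm_eq_abs, sq_abs]
  ring

lemma sphHeight_sphInv (p : OnePoint ℂ) : sphHeight (sphInv p) = 1 - sphHeight p := by
  rw [sphHeight, stereo_sphInv]; rfl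

lemma continuous_stereo_coe : Continuous fun z : ℂ => stereo (z : OnePoint ℂ) := by
  simp only [stereo_coe]
  refine (WithLp.prod_continuous_toLp 2 ℂ ℝ).comp (Continuous.prodMk ?_ ?_)
  · refine continuous_id.div (by fun_prop) fun z => ?_
    have : (1 + ‖z‖ ^ 2 : ℝ) ≠ 0 := by positivity
    exact_mod_cast this
  · exact continuous_const.div (by fun_prop) fun z => by positivity

lemma continuous_stereo_sphInv_coe : Continuous fun z : ℂ => stereo (sphInv (z : OnePoint ℂ)) := by
  simp only [stereo_sphInv]
  refine (WithLp.prod_continuous_toLp 2 ℂ ℝ).comp (Continuous.prodMk ?_ ?_)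
  · exact Complex.continuous_conj.comp
      ((WithLp.prod_continuous_ofLp 2 ℂ ℝ).comp continuous_stereo_coe).fst
  · exact continuous_const.sub ((WithLp.prod_continuous_ofLp 2 ℂ ℝ).comp continuous_stereo_coe).snd

lemma SphHolomorphicOn.sphInv_comp {f : ℂ → OnePoint ℂ} {U : Set ℂ} (hf : SphHolomorphicOn f U) :
    SphHolomorphicOn (sphInv ∘ f) U := by
  intro z hz
  obtain ⟨V, hV, hzV, h, hd, hh | hh⟩ := hf z hz
  · exact ⟨V, hV, hzV, h, hd, Or.inr fun w hw => by rw [Function.comp_apply, hh w hw]; rfl⟩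
  · refine ⟨V, hV, hzV, h, hd, Or.inl fun w hw => ?_⟩
    rw [Function.comp_apply, hh w hw]
    exact sphInv_sphInv (h w)

lemma SphHolomorphicOn.continuousAt_stereo {f : ℂ → OnePoint ℂ} {U : Set ℂ}
    (hf : SphHolomorphicOn f U) {z : ℂ} (hz : z ∈ U) : ContinuousAt (stereo ∘ f) z := by
  obtain ⟨V, hV, hzV, h, hd, hh | hh⟩ := hf z hz
  all_goals
    have hc : ContinuousAt h z := (hd.differentiableAt (hV.mem_nhds hzV)).continuousAt
  · refine (continuous_stereo_coe.continuousAt.comp hc).congr ?_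
    filter_upwards [hV.mem_nhds hzV] with w hw
    simp [hh w hw]
  · refine (continuous_stereo_sphInv_coe.continuousAt.comp hc).congr ?_
    filter_upwards [hV.mem_nhds hzV] with w hw
    simp only [Function.comp_apply, hh w hw]
    rfl

lemma SphHolomorphicOn.continuousAt_sphHeight {f : ℂ → OnePoint ℂ} {U : Set ℂ}
    (hf : SphHolomorphicOn f U) {z : ℂ} (hz : z ∈ U) : ContinuousAt (sphHeight ∘ f) z :=
  ((WithLp.prod_continuous_ofLp 2 ℂ ℝ).snd.continuousAt).comp (hf.continuousAt_stereo hz)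

lemma SphHolomorphicOn.differentiableAt_sphFin {f : ℂ → OnePoint ℂ} {U : Set ℂ}
    (hf : SphHolomorphicOn f U) {z : ℂ} (hz : z ∈ U) (hfz : f z ≠ OnePoint.infty) :
    DifferentiableAt ℂ (sphFin ∘ f) z := by
  obtain ⟨V, hV, hzV, h, hd, hh | hh⟩ := hf z hz
  all_goals
    have hda : DifferentiableAt ℂ h z := hd.differentiableAt (hV.mem_nhds hzV)
  · refine hda.congr_of_eventuallyEq ?_
    filter_upwards [hV.mem_nhds hzV] with w hw
    simp only [Function.comp_apply, hh w hw]
    rfl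
  · have h0 : h z ≠ 0 := fun h0 => hfz (by rw [hh z hzV, if_pos h0])
    refine (hda.inv h0).congr_of_eventuallyEq ?_
    filter_upwards [hV.mem_nhds hzV, hda.continuousAt.eventually_ne h0] with w hw hw0
    simp only [Function.comp_apply, hh w hw, if_neg hw0]
    rfl

/-- Nearby points on the sphere are close in the plane, if one of them is not too large. -/
lemma exists_coe_of_sphDist_lt {u : ℂ} {q : OnePoint ℂ} (hu : ‖u‖ ≤ 2)
    (h : sphDist q (u : OnePoint ℂ) < 1 / 100) :
    ∃ v : ℂ, q = (v : OnePoint ℂ) ∧ ‖v - u‖ ≤ 1 / 10 := by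
  have hs : ∀ z : ℂ, Real.sqrt (1 + ‖z‖ ^ 2) ≤ 1 + ‖z‖ := fun z =>
    Real.sqrt_le_iff.2 ⟨by positivity, by nlinarith [norm_nonneg z]⟩
  have hp : ∀ z : ℂ, 0 < Real.sqrt (1 + ‖z‖ ^ 2) := fun z => Real.sqrt_pos.2 (by positivity)
  induction q using OnePoint.rec with
  | infty =>
    simp only [sphDist] at h
    rw [div_lt_iff₀ (hp u)] at h
    linarith [hs u]
  | coe v =>
    refine ⟨v, rfl, ?_⟩
    simp only [sphDist] at h
    rw [div_lt_iff₀ (mul_pos (hp v) (hp u))] at h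
    have h1 : Real.sqrt (1 + ‖v‖ ^ 2) * Real.sqrt (1 + ‖u‖ ^ 2) ≤ (1 + ‖v‖) * 3 :=
      mul_le_mul (hs v) (by linarith [hs u]) (hp u).le (by positivity)
    have h2 : ‖v‖ ≤ ‖v - u‖ + ‖u‖ := by simpa using norm_add_le (v - u) u
    linarith

lemma exists_coe_of_le_sphHeight {p : OnePoint ℂ} {c : ℝ} (hc : 0 ≤ c)
    (h : 1 / (1 + c ^ 2) ≤ sphHeight p) : ∃ v : ℂ, p = (v : OnePoint ℂ) ∧ ‖v‖ ≤ c := by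
  induction p using OnePoint.rec with
  | infty =>
    rw [sphHeight_infty] at h
    have : 0 < 1 / (1 + c ^ 2) := by positivity
    linarith
  | coe v =>
    refine ⟨v, rfl, ?_⟩
    rw [sphHeight_coe, one_div_le_one_div (by positivity) (by positivity)] at h
    exact abs_le_of_sq_le_sq' (by linarith) hc |>.2

lemma norm_circleIntegral_inv_smul_sub_le {h : ℂ → ℂ} {a : ℂ} {δ r : ℝ} (hr : 0 < r)
    (hc : ∀ z : ℂ, ‖z‖ = r → ContinuousAt h z) (hb : ∀ z : ℂ, ‖z‖ = r → ‖h z - a‖ ≤ δ) :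
    ‖(∮ z in C(0, r), (z - 0)⁻¹ • h z) - 2 * Real.pi * Complex.I * a‖ ≤ 2 * Real.pi * δ := by
  have h0 : ∀ z : ℂ, ‖z‖ = r → z - 0 ≠ 0 := by
    rintro z hz h
    rw [sub_zero] at h
    simp [h] at hz
    linarith
  have hi : ContinuousOn (fun z : ℂ => (z - 0)⁻¹) (Metric.sphere 0 r) := fun z hz =>
    ((continuousAt_id.sub continuousAt_const).inv₀ (h0 z (by simpa using hz))).continuousWithinAt
  have hh : ContinuousOn h (Metric.sphere 0 r) := fun z hz =>
    (hc z (by simpa using hz)).continuousWithinAt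
  have e : (∮ z in C(0, r), (z - 0)⁻¹ • h z) - 2 * Real.pi * Complex.I * a =
      ∮ z in C(0, r), (z - 0)⁻¹ • (h z - a) := by
    simp only [smul_sub]
    have h1 : CircleIntegrable (fun z => (z - 0)⁻¹ • h z) 0 r :=
      (hi.smul hh).circleIntegrable hr.le
    have h2 : CircleIntegrable (fun z : ℂ => (z - 0)⁻¹ • a) 0 r :=
      (hi.smul continuousOn_const).circleIntegrable hr.le
    rw [circleIntegral.integral_sub h1 h2, circleIntegral.integral_smul_const,
      circleIntegral.integral_sub_center_inv _ hr.ne', smul_eq_mul]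
  rw [e]
  refine (circleIntegral.norm_integral_le_of_norm_le_const hr.le (C := r⁻¹ * δ) ?_).trans
    (le_of_eq (by field_simp))
  intro z hz
  have hz' : ‖z‖ = r := by simpa using hz
  rw [norm_smul, sub_zero, norm_inv, hz']
  exact mul_le_mul_of_nonneg_left (hb z hz') (by positivity)

/-- A function holomorphic on a closed annulus which is almost constant on both boundary circles
has almost the same value on both. -/
lemma norm_sub_le_of_near_const_on_circles {h : ℂ → ℂ} {a b : ℂ} {δ r R : ℝ} (hr : 0 < r)
    (hrR : r ≤ R) (hd : ∀ z : ℂ, r ≤ ‖z‖ → ‖z‖ ≤ R → DifferentiableAt ℂ h z)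
    (ha : ∀ z : ℂ, ‖z‖ = r → ‖h z - a‖ ≤ δ) (hb : ∀ z : ℂ, ‖z‖ = R → ‖h z - b‖ ≤ δ) :
    ‖a - b‖ ≤ 2 * δ := by
  have e := Complex.circleIntegral_sub_center_inv_smul_eq_of_differentiable_on_annulus_off_countable
    (c := 0) hr hrR (f := h) countable_empty
    (fun z hz => (hd z (by simpa using hz.2) (by simpa using hz.1)).continuousAt.continuousWithinAt)
    (fun z hz => hd z (by simpa using hz.1.2 : r < ‖z‖).le (by simpa using hz.1.1 : ‖z‖ < R).le)
  have h1 := norm_circleIntegral_inv_smul_sub_le hr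
    (fun z hz => (hd z hz.ge (hz.le.trans hrR)).continuousAt) ha
  have h2 := norm_circleIntegral_inv_smul_sub_le (hr.trans_le hrR)
    (fun z hz => (hd z (hrR.trans hz.ge) hz.le).continuousAt) hb
  rw [e] at h2
  have h3 := norm_sub_le_of_le h2 h1
  have e3 : ∀ I : ℂ, (I - 2 * Real.pi * Complex.I * b) - (I - 2 * Real.pi * Complex.I * a) =
      2 * Real.pi * Complex.I * (a - b) := fun I => by ring
  rw [e3] at h3
  simp only [norm_mul, Complex.norm_I, Complex.norm_real, Complex.norm_ofNat,
    Real.norm_of_nonneg Real.pi_pos.le] at h3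
  nlinarith [Real.pi_pos]

lemma exists_coe_of_near_const_on_circles {f : ℂ → OnePoint ℂ} {r₀ : ℝ} (hr₀ : 0 < r₀)
    (hr₁ : r₀ < 1) (hf : SphHolomorphicOn f (Metric.ball 0 1 \ {0}))
    (hosc : ∀ z : ℂ, z ≠ 0 → ‖z‖ ≤ r₀ → sphDist (f z) (f (‖z‖ : ℂ)) < 1 / 100)
    (hh : 1 / 2 ≤ sphHeight (f (r₀ : ℂ))) :
    ∀ z : ℂ, z ≠ 0 → ‖z‖ ≤ r₀ → ∃ w : ℂ, f z = (w : OnePoint ℂ) ∧ ‖w‖ ≤ 2 := by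
  have hmem : ∀ z : ℂ, z ≠ 0 → ‖z‖ ≤ r₀ → z ∈ Metric.ball (0 : ℂ) 1 \ {0} := fun z hz hzr =>
    ⟨by simpa using hzr.trans_lt hr₁, by simpa using hz⟩
  have hcont : ∀ t : ℝ, 0 < t → t ≤ r₀ → ContinuousAt (fun t : ℝ => sphHeight (f (t : ℂ))) t := by
    intro t ht htr
    have hm := hmem (t : ℂ) (by exact_mod_cast ht.ne') (by simpa [abs_of_pos ht] using htr)
    exact ContinuousAt.comp (f := fun t : ℝ => (t : ℂ)) (hf.continuousAt_sphHeight hm)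
      Complex.continuous_ofReal.continuousAt
  have hnear : ∀ z : ℂ, z ≠ 0 → ‖z‖ ≤ r₀ → 4 / 13 ≤ sphHeight (f (‖z‖ : ℂ)) →
      ∃ u v : ℂ, f (‖z‖ : ℂ) = (u : OnePoint ℂ) ∧ ‖u‖ ≤ 3 / 2 ∧ f z = (v : OnePoint ℂ) ∧
        ‖v - u‖ ≤ 1 / 10 := by
    intro z hz hzr hzh
    obtain ⟨u, hu, hun⟩ := exists_coe_of_le_sphHeight (c := 3 / 2) (by norm_num)
      (le_trans (by norm_num) hzh)
    have h1 := hosc z hz hzr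
    rw [hu] at h1
    obtain ⟨v, hv, hvn⟩ := exists_coe_of_sphDist_lt (by linarith) h1
    exact ⟨u, v, hu, hun, hv, hvn⟩
  have hgood : ∀ s : ℝ, 0 < s → s ≤ r₀ → 4 / 13 < sphHeight (f (s : ℂ)) := by
    intro s hs hsr
    by_contra! hbad
    have hco : ContinuousOn (fun t : ℝ => sphHeight (f (t : ℂ))) (Icc s r₀) := fun t ht =>
      (hcont t (hs.trans_le ht.1) ht.2).continuousWithinAt
    have hcpt : IsCompact (Icc s r₀ ∩ (fun t : ℝ => sphHeight (f (t : ℂ))) ⁻¹' Iic (4 / 13)) :=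
      isCompact_Icc.of_isClosed_subset
        (hco.preimage_isClosed_of_isClosed isClosed_Icc isClosed_Iic) inter_subset_left
    obtain ⟨τ, ⟨⟨hτs, hτr⟩, hτb⟩, hτmax⟩ := hcpt.exists_isGreatest ⟨s, ⟨le_rfl, hsr⟩, hbad⟩
    have hτ0 : 0 < τ := hs.trans_le hτs
    simp only [mem_preimage, mem_Iic] at hτb
    have hτlt : τ < r₀ := lt_of_le_of_ne hτr fun h => by rw [h] at hτb; linarith
    have hup : ∀ t : ℝ, τ < t → t ≤ r₀ → 4 / 13 ≤ sphHeight (f (t : ℂ)) := by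
      intro t ht htr
      by_contra! hlt
      exact absurd (hτmax ⟨⟨hτs.trans ht.le, htr⟩, hlt.le⟩) (not_le.2 ht)
    have hclaim : ∀ t : ℝ, τ < t → t ≤ r₀ → 1 / (1 + (6 / 5) ^ 2) ≤ sphHeight (f (t : ℂ)) := by
      intro t ht htr
      have ht0 := hτ0.trans ht
      have hcirc : ∀ z : ℂ, t ≤ ‖z‖ → ‖z‖ ≤ r₀ → z ≠ 0 ∧ ∃ u v : ℂ, f (‖z‖ : ℂ) = (u : OnePoint ℂ) ∧
          ‖u‖ ≤ 3 / 2 ∧ f z = (v : OnePoint ℂ) ∧ ‖v - u‖ ≤ 1 / 10 := fun z hz hzr =>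
        have hz0 : z ≠ 0 := norm_pos_iff.1 (ht0.trans_le hz)
        ⟨hz0, hnear z hz0 hzr (hup _ (ht.trans_le hz) hzr)⟩
      have hosc' : ∀ z : ℂ, t ≤ ‖z‖ → ‖z‖ ≤ r₀ →
          ‖(sphFin ∘ f) z - sphFin (f (‖z‖ : ℂ))‖ ≤ 1 / 10 := by
        intro z hz hzr
        obtain ⟨-, u, v, hu, -, hv, hvn⟩ := hcirc z hz hzr
        rwa [Function.comp_apply, hu, hv, sphFin_coe, sphFin_coe]
      have hfin : ‖sphFin (f (t : ℂ)) - sphFin (f (r₀ : ℂ))‖ ≤ 2 * (1 / 10) := by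
        refine norm_sub_le_of_near_const_on_circles (h := sphFin ∘ f) ht0 htr ?_ ?_ ?_
        · intro z hz hzr
          obtain ⟨hz0, u, v, -, -, hv, -⟩ := hcirc z hz hzr
          exact hf.differentiableAt_sphFin (hmem z hz0 hzr)
            (by rw [hv]; exact OnePoint.coe_ne_infty v)
        · intro z hz
          have := hosc' z hz.ge (hz.le.trans htr)
          rwa [hz] at this
        · intro z hz
          have := hosc' z (htr.trans hz.ge) hz.le
          rwa [hz] at this
      obtain ⟨a, ha, han⟩ := exists_coe_of_le_sphHeight (c := 1) (by norm_num)
        (le_trans (by norm_num) hh)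
      obtain ⟨b, hb, -⟩ := exists_coe_of_le_sphHeight (c := 3 / 2) (by norm_num)
        (le_trans (by norm_num) (hup t ht htr))
      rw [ha, hb, sphFin_coe, sphFin_coe] at hfin
      have hbn : ‖b‖ ≤ 6 / 5 := by
        have : ‖b‖ ≤ ‖b - a‖ + ‖a‖ := by simpa using norm_add_le (b - a) a
        linarith
      rw [hb, sphHeight_coe]
      gcongr
    have hlim : 1 / (1 + (6 / 5 : ℝ) ^ 2) ≤ sphHeight (f (τ : ℂ)) := by
      refine ge_of_tendsto ((hcont τ hτ0 hτr).tendsto.mono_left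
        (nhdsWithin_le_nhds (s := Ioi τ))) ?_
      filter_upwards [Ioc_mem_nhdsGT hτlt] with t ht
      exact hclaim t ht.1 ht.2
    norm_num at hlim
    linarith
  intro z hz hzr
  obtain ⟨u, v, -, hu, hv, hvn⟩ := hnear z hz hzr (hgood _ (norm_pos_iff.2 hz) hzr).le
  refine ⟨v, hv, ?_⟩
  have : ‖v‖ ≤ ‖v - u‖ + ‖u‖ := by simpa using norm_add_le (v - u) u
  linarith

/-- A map into the sphere which is bounded near an isolated singularity extends across it. -/
lemma exists_extension_of_bounded {f : ℂ → OnePoint ℂ} {r₀ : ℝ} (hr₀ : 0 < r₀) (hr₁ : r₀ < 1)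
    (hf : SphHolomorphicOn f (Metric.ball 0 1 \ {0}))
    (hb : ∀ z : ℂ, z ≠ 0 → ‖z‖ ≤ r₀ → ∃ w : ℂ, f z = (w : OnePoint ℂ) ∧ ‖w‖ ≤ 2) :
    ∃ F : ℂ → OnePoint ℂ, SphHolomorphicOn F (Metric.ball (0 : ℂ) 1) ∧
      ∀ z ∈ Metric.ball (0 : ℂ) 1 \ {0}, F z = f z := by
  have hd : DifferentiableOn ℂ (sphFin ∘ f) (Metric.ball 0 r₀ \ {0}) := by
    rintro z ⟨hz, hz0⟩
    have hzr : ‖z‖ < r₀ := by simpa using hz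
    obtain ⟨w, hw, -⟩ := hb z hz0 hzr.le
    exact (hf.differentiableAt_sphFin ⟨by simpa using hzr.trans hr₁, hz0⟩
      (by rw [hw]; exact OnePoint.coe_ne_infty w)).differentiableWithinAt
  have hbd : BddAbove (norm ∘ (sphFin ∘ f) '' (Metric.ball 0 r₀ \ {0})) := by
    refine ⟨2, ?_⟩
    rintro _ ⟨z, ⟨hz, hz0⟩, rfl⟩
    have hzr : ‖z‖ < r₀ := by simpa using hz
    obtain ⟨w, hw, hwn⟩ := hb z hz0 hzr.le
    simpa [hw, sphFin_coe] using hwn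
  have hext := Complex.differentiableOn_update_limUnder_of_bddAbove
    (Metric.ball_mem_nhds (0 : ℂ) hr₀) hd hbd
  set l := limUnder (𝓝[≠] (0 : ℂ)) (sphFin ∘ f)
  refine ⟨Function.update f 0 (l : OnePoint ℂ), ?_, fun z hz => Function.update_of_ne hz.2 _ _⟩
  intro z hz
  by_cases hz0 : z = 0
  · refine ⟨Metric.ball 0 r₀, Metric.isOpen_ball, by simpa [hz0] using hr₀, _, hext,
      Or.inl fun w hw => ?_⟩
    by_cases hw0 : w = 0
    · simp [hw0]
    · have hwr : ‖w‖ < r₀ := by simpa using hw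
      obtain ⟨v, hv, -⟩ := hb w hw0 hwr.le
      simp [Function.update_of_ne hw0, hv, sphFin_coe]
  · obtain ⟨V, hV, hzV, h, hdh, hh⟩ := hf z ⟨hz, hz0⟩
    refine ⟨V \ {0}, hV.sdiff isClosed_singleton, ⟨hzV, hz0⟩, h, hdh.mono sdiff_subset, ?_⟩
    refine hh.imp (fun hh w hw => ?_) (fun hh w hw => ?_) <;>
      rw [Function.update_of_ne hw.2, hh w hw.1]

lemma exp_affine_mem {a : ℝ} (ha : a < 0) {ζ : ℂ} (hζ : ζ ∈ Metric.ball (0 : ℂ) 1) :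
    Complex.exp (a - a * ζ) ∈ Metric.ball (0 : ℂ) 1 \ {0} := by
  have hζ' : ‖ζ‖ < 1 := by simpa using hζ
  refine ⟨?_, by simp⟩
  rw [mem_ball_zero_iff, Complex.norm_exp, Real.exp_lt_one_iff]
  have h := Complex.re_le_norm ζ
  simp only [Complex.sub_re, Complex.ofReal_re, Complex.re_ofReal_mul]
  nlinarith

lemma isConnected_punctured_ball : IsConnected (Metric.ball (0 : ℂ) 1 \ {0}) := by
  have himg : Complex.exp '' {z : ℂ | z.re < 0} = Metric.ball (0 : ℂ) 1 \ {0} := by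
    ext z
    constructor
    · rintro ⟨w, hw, rfl⟩
      exact ⟨by simpa [Complex.norm_exp] using hw, by simp⟩
    · rintro ⟨hz, hz0⟩
      refine ⟨Complex.log z, ?_, Complex.exp_log hz0⟩
      rw [mem_ofPred_eq, Complex.log_re]
      exact Real.log_neg (norm_pos_iff.2 hz0) (by simpa using hz)
  rw [← himg]
  refine IsConnected.image ⟨⟨-1, by simp⟩, ?_⟩ _ Complex.continuous_exp.continuousOn
  exact (convex_halfSpace_re_lt 0).isPreconnected

/-- A compact property gives an equicontinuous family at the centre of the unit disk. -/
lemma IsCompactProperty.equicontinuous_at_zero {P : Set ℂ → (ℂ → OnePoint ℂ) → Prop}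
    (hP : IsCompactProperty P) {ε : ℝ} (hε : 0 < ε) :
    ∃ η > 0, ∀ G : ℂ → OnePoint ℂ, P (Metric.ball 0 1) G →
      ∀ ζ : ℂ, ‖ζ‖ < η → sphDist (G ζ) (G 0) < ε := by
  by_contra! hcon
  choose G hG ζ hζ hζε using fun n : ℕ => hcon (1 / ((n : ℝ) + 1)) (by positivity)
  have hconn : IsConnected (Metric.ball (0 : ℂ) 1) :=
    (convex_ball _ _).isConnected ⟨0, by simp⟩
  obtain ⟨φ, hφ, g, hg⟩ := hP.normal _ Metric.isOpen_ball hconn G hG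
  have hev := hg (Metric.closedBall 0 (1 / 2)) (Metric.closedBall_subset_ball (by norm_num))
    (isCompact_closedBall _ _) (ε / 5) (by positivity)
  obtain ⟨N, hN⟩ := eventually_atTop.1 hev
  have hc := (hP.mem_holo _ _ Metric.isOpen_ball hconn (hG (φ N))).continuousAt_stereo
    (z := 0) (by simp)
  have hζ0 : Tendsto (fun n => ζ (φ n)) atTop (𝓝 0) := by
    refine Tendsto.comp (squeeze_zero_norm (fun n => (hζ n).le) ?_) hφ.tendsto_atTop
    exact tendsto_one_div_add_atTop_nhds_zero_nat
  have h1 := hζ0.eventually (Metric.continuousAt_iff'.1 hc (ε / 5) (by positivity))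
  have h2 := hζ0.eventually (Metric.closedBall_mem_nhds (0 : ℂ) (by norm_num : (0 : ℝ) < 1 / 2))
  obtain ⟨n, hn1, hn2, hnN⟩ := (h1.and (h2.and (eventually_ge_atTop N))).exists
  have h0 : (0 : ℂ) ∈ Metric.closedBall (0 : ℂ) (1 / 2) := by simp
  have k1 := hN n hnN _ hn2
  have k2 := hN n hnN _ h0
  have k3 := hN N le_rfl _ hn2
  have k4 := hN N le_rfl _ h0
  have k5 := hζε (φ n)
  simp only [sphDist_eq_dist_stereo, Function.comp_apply] at k1 k2 k3 k4 k5 hn1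
  rw [dist_comm] at k2 k3
  have t1 := dist_triangle4 (stereo (G (φ n) (ζ (φ n)))) (stereo (g (ζ (φ n))))
    (stereo (G (φ N) (ζ (φ n)))) (stereo (G (φ N) 0))
  have t2 := dist_triangle4 (stereo (G (φ n) (ζ (φ n)))) (stereo (G (φ N) 0))
    (stereo (g 0)) (stereo (G (φ n) 0))
  linarith

/-- A map with a compact property on the punctured disk is almost constant on small circles. -/
lemma IsCompactProperty.near_const_on_small_circles {P : Set ℂ → (ℂ → OnePoint ℂ) → Prop}
    (hP : IsCompactProperty P) {f : ℂ → OnePoint ℂ} (hf : P (Metric.ball (0 : ℂ) 1 \ {0}) f)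
    {ε : ℝ} (hε : 0 < ε) :
    ∃ r₀ : ℝ, 0 < r₀ ∧ r₀ < 1 ∧
      ∀ z : ℂ, z ≠ 0 → ‖z‖ ≤ r₀ → sphDist (f z) (f (‖z‖ : ℂ)) < ε := by
  obtain ⟨η, hη, hequi⟩ := hP.equicontinuous_at_zero hε
  have hq : 0 < 4 / η := by positivity
  refine ⟨Real.exp (-(4 / η)), Real.exp_pos _, by simpa using hq, fun z hz hzr => ?_⟩
  set a := Real.log ‖z‖ with ha
  have hza : a ≤ -(4 / η) := by
    rw [ha, ← Real.log_exp (-(4 / η))]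
    exact Real.log_le_log (norm_pos_iff.2 hz) hzr
  have ha0 : a < 0 := by linarith
  have hac : (a : ℂ) ≠ 0 := by exact_mod_cast ha0.ne
  have hder : ∀ ζ : ℂ, HasDerivAt (fun ζ : ℂ => Complex.exp (a - a * ζ))
      (Complex.exp (a - a * ζ) * -(a * 1)) ζ := fun ζ =>
    (((hasDerivAt_id ζ).const_mul (a : ℂ)).const_sub (a : ℂ)).cexp
  have hPG : P (Metric.ball 0 1) (f ∘ fun ζ : ℂ => Complex.exp (a - a * ζ)) := by
    refine hP.comp _ _ _ f Metric.isOpen_ball ((convex_ball _ _).isConnected ⟨0, by simp⟩)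
      (Metric.isOpen_ball.sdiff isClosed_singleton) isConnected_punctured_ball
      (fun ζ _ => (hder ζ).differentiableAt.differentiableWithinAt)
      (fun ζ hζ => exp_affine_mem ha0 hζ) (fun ζ _ => ?_) hf
    rw [(hder ζ).deriv]
    simp [hac, Complex.exp_ne_zero]
  have hfin := hequi _ hPG (-(z.arg * Complex.I) / a) ?_
  · have e1 : (a : ℂ) - a * (-(z.arg * Complex.I) / a) = Complex.log z := by
      rw [mul_div_cancel₀ _ hac, Complex.log]
      ring
    have e2 : Complex.exp (a : ℂ) = (‖z‖ : ℂ) := by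
      rw [← Complex.ofReal_exp, ha, Real.exp_log (norm_pos_iff.2 hz)]
    simpa only [Function.comp_apply, e1, Complex.exp_log hz, mul_zero, sub_zero, e2] using hfin
  · rw [norm_div, norm_neg, norm_mul, Complex.norm_I, mul_one, Complex.norm_real,
      Complex.norm_real, Real.norm_eq_abs, Real.norm_eq_abs, abs_of_neg ha0,
      div_lt_iff₀ (by linarith)]
    have h1 := Complex.abs_arg_le_pi z
    have h2 : η * (4 / η) = 4 := by field_simp
    nlinarith [Real.pi_lt_four]

/-- If `f` satisfies a compact property `P` on the punctured unit disk, then `0` is not an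
essential singularity of `f`: `f` extends to a holomorphic map of the whole disk into the
Riemann sphere. -/
theorem compact_property_removable_singularity
    (P : Set ℂ → (ℂ → OnePoint ℂ) → Prop) (hP : IsCompactProperty P)
    (f : ℂ → OnePoint ℂ) (hf : P (Metric.ball (0:ℂ) 1 \ {0}) f) :
    ∃ F : ℂ → OnePoint ℂ, SphHolomorphicOn F (Metric.ball (0:ℂ) 1) ∧
      ∀ z ∈ Metric.ball (0:ℂ) 1 \ {0}, F z = f z := by
  have hU : IsOpen (Metric.ball (0 : ℂ) 1 \ {0}) := Metric.isOpen_ball.sdiff isClosed_singleton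
  have hhol := hP.mem_holo _ _ hU isConnected_punctured_ball hf
  obtain ⟨r₀, hr₀, hr₁, hosc⟩ := hP.near_const_on_small_circles hf (ε := 1 / 100) (by norm_num)
  rcases le_total (1 / 2) (sphHeight (f (r₀ : ℂ))) with hh | hh
  · exact exists_extension_of_bounded hr₀ hr₁ hhol
      (exists_coe_of_near_const_on_circles hr₀ hr₁ hhol hosc hh)
  · obtain ⟨F, hF, hFf⟩ := exists_extension_of_bounded hr₀ hr₁ hhol.sphInv_comp
      (exists_coe_of_near_const_on_circles hr₀ hr₁ hhol.sphInv_comp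
        (fun z hz hzr => (sphDist_sphInv _ _).trans_lt (hosc z hz hzr))
        (by rw [Function.comp_apply, sphHeight_sphInv]; linarith))
    refine ⟨sphInv ∘ F, hF.sphInv_comp, fun z hz => ?_⟩
    rw [Function.comp_apply, hFf z hz, Function.comp_apply, sphInv_sphInv]

end
end

section
/- For every L > 0 and every positive integer m, the compact property P_L (defined by: |f| < L on Σ or f constant) satisfies the m-curvature estimate. In particular, there exists a constant C = C(L, m) > 0 such that for every Weierstrass m-triple (Σ, f dz, g) with |g| < L on Σ, the inequality |K_{ds²}(p)|^{1/2} ≤ C / d(p) holds for all p ∈ Σ, where K_{ds²} is the Gaussian curvature of ds² = (1+|g|²)^m |f|² |dz|² and d(p) is the geodesic distance from p to the boundary of Σ with respect to ds². -/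
open Filter Set MeasureTheory Topology
open scoped ENNReal

noncomputable section

@[simp] lemma sphDist_infty_infty : sphDist OnePoint.infty OnePoint.infty = 0 := rfl

@[simp] lemma sphDist_infty_coe (w : ℂ) :
    sphDist OnePoint.infty (w : OnePoint ℂ) = 1 / Real.sqrt (1 + ‖w‖ ^ 2) := rfl

@[simp] lemma sphDist_coe_infty (z : ℂ) :
    sphDist (z : OnePoint ℂ) OnePoint.infty = 1 / Real.sqrt (1 + ‖z‖ ^ 2) := rfl

@[simp] lemma sphDist_coe_coe (z w : ℂ) : sphDist (z : OnePoint ℂ) (w : OnePoint ℂ) =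
    ‖z - w‖ / (Real.sqrt (1 + ‖z‖ ^ 2) * Real.sqrt (1 + ‖w‖ ^ 2)) := rfl

/-- The horizontal coordinate of the stereographic projection. -/
def stereoC (x : OnePoint ℂ) : ℂ := x.elim 0 fun z => z / ((1 + ‖z‖ ^ 2 : ℝ) : ℂ)

/-- One minus the height of the stereographic projection onto the sphere of diameter one. -/
def stereoR (x : OnePoint ℂ) : ℝ := x.elim 0 fun z => 1 / (1 + ‖z‖ ^ 2)

@[simp] lemma stereoC_infty : stereoC OnePoint.infty = 0 := rfl
@[simp] lemma stereoC_coe (z : ℂ) : stereoC z = z / ((1 + ‖z‖ ^ 2 : ℝ) : ℂ) := rfl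
@[simp] lemma stereoR_infty : stereoR OnePoint.infty = 0 := rfl
@[simp] lemma stereoR_coe (z : ℂ) : stereoR z = 1 / (1 + ‖z‖ ^ 2) := rfl

lemma sphDist_nonneg (x y : OnePoint ℂ) : 0 ≤ sphDist x y := by
  induction x using OnePoint.rec <;> induction y using OnePoint.rec <;> (simp; try positivity)

lemma sphDist_self (x : OnePoint ℂ) : sphDist x x = 0 := by
  induction x using OnePoint.rec <;> simp

lemma sphDist_coe_coe_le (z w : ℂ) : sphDist (z : OnePoint ℂ) (w : OnePoint ℂ) ≤ ‖z - w‖ := by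
  rw [sphDist_coe_coe]
  refine div_le_self (norm_nonneg _) ?_
  exact one_le_mul_of_one_le_of_one_le (Real.one_le_sqrt.2 (by nlinarith [sq_nonneg ‖z‖]))
    (Real.one_le_sqrt.2 (by nlinarith [sq_nonneg ‖w‖]))

lemma sphDist_sq (x y : OnePoint ℂ) :
    sphDist x y ^ 2 = ‖stereoC x - stereoC y‖ ^ 2 + (stereoR x - stereoR y) ^ 2 := by
  have key : ∀ w : ℂ, (1 / Real.sqrt (1 + ‖w‖ ^ 2)) ^ 2 =
      ‖w / ((1 + ‖w‖ ^ 2 : ℝ) : ℂ)‖ ^ 2 + (1 / (1 + ‖w‖ ^ 2)) ^ 2 := fun w => by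
    have h : 0 < 1 + ‖w‖ ^ 2 := by positivity
    rw [div_pow, Real.sq_sqrt h.le, norm_div, Complex.norm_real, Real.norm_of_nonneg h.le]
    field_simp
    ring
  induction x using OnePoint.rec with
  | infty =>
    induction y using OnePoint.rec with
    | infty => simp
    | coe w => rw [sphDist_infty_coe, key]; simp
  | coe z =>
    induction y using OnePoint.rec with
    | infty => rw [sphDist_coe_infty, key]; simp
    | coe w =>
      have hz : 0 < 1 + ‖z‖ ^ 2 := by positivity
      have hw : 0 < 1 + ‖w‖ ^ 2 := by positivity
      rw [sphDist_coe_coe, div_pow, mul_pow, Real.sq_sqrt hz.le, Real.sq_sqrt hw.le,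
        stereoC_coe, stereoC_coe, stereoR_coe, stereoR_coe]
      simp only [Complex.sq_norm, Complex.normSq_apply, Complex.sub_re, Complex.sub_im,
        Complex.div_ofReal_re, Complex.div_ofReal_im] at *
      field_simp
      ring

lemma norm_stereoC_sub_le (x y : OnePoint ℂ) : ‖stereoC x - stereoC y‖ ≤ sphDist x y := by
  refine le_of_sq_le_sq ?_ (sphDist_nonneg x y)
  nlinarith [sphDist_sq x y, sq_nonneg (stereoR x - stereoR y)]

lemma abs_stereoR_sub_le (x y : OnePoint ℂ) : |stereoR x - stereoR y| ≤ sphDist x y := by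
  refine abs_le_of_sq_le_sq ?_ (sphDist_nonneg x y)
  nlinarith [sphDist_sq x y, sq_nonneg ‖stereoC x - stereoC y‖]

lemma stereoR_pos_coe (z : ℂ) : 0 < stereoR z := by
  rw [stereoR_coe]; positivity

lemma eq_of_stereo_eq {x y : OnePoint ℂ} (hC : stereoC x = stereoC y)
    (hR : stereoR x = stereoR y) : x = y := by
  induction x using OnePoint.rec with
  | infty =>
    induction y using OnePoint.rec with
    | infty => rfl
    | coe w => exact absurd hR (stereoR_pos_coe w).ne
  | coe z =>
    induction y using OnePoint.rec with
    | infty => exact absurd hR (stereoR_pos_coe z).ne'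
    | coe w =>
      have hz : 0 < 1 + ‖z‖ ^ 2 := by positivity
      have hw : 0 < 1 + ‖w‖ ^ 2 := by positivity
      rw [stereoR_coe, stereoR_coe, div_eq_div_iff hz.ne' hw.ne', one_mul, one_mul] at hR
      rw [stereoC_coe, stereoC_coe, hR, div_left_inj' (by exact_mod_cast hz.ne')] at hC
      rw [hC]

/-- A sphere-valued holomorphic map avoiding `∞` is the coercion of a holomorphic function. -/
lemma SphHolomorphicOn.exists_eq_coe {f : ℂ → OnePoint ℂ} {U : Set ℂ} (hf : SphHolomorphicOn f U)
    (hfin : ∀ z ∈ U, f z ≠ OnePoint.infty) :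
    ∃ h : ℂ → ℂ, DifferentiableOn ℂ h U ∧ ∀ z ∈ U, f z = (h z : OnePoint ℂ) := by
  refine ⟨fun z => (f z).elim 0 id, fun z hz => ?_, fun z hz => ?_⟩
  · obtain ⟨V, hV, hzV, h, hh, h1 | h1⟩ := hf z hz
    · refine DifferentiableAt.differentiableWithinAt ?_
      refine (hh.differentiableAt (hV.mem_nhds hzV)).congr_of_eventuallyEq ?_
      filter_upwards [hV.mem_nhds hzV] with w hw
      simp [h1 w hw]
    · have hz0 : h z ≠ 0 := fun h0 => hfin z hz (by simp [h1 z hzV, h0])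
      have hd := hh.differentiableAt (hV.mem_nhds hzV)
      refine DifferentiableAt.differentiableWithinAt ?_
      refine (hd.inv hz0).congr_of_eventuallyEq ?_
      filter_upwards [hV.mem_nhds hzV, hd.continuousAt.eventually_ne hz0] with w hw hw0
      simp [h1 w hw, hw0]
  · obtain ⟨w, hw⟩ := OnePoint.ne_infty_iff_exists.1 (hfin z hz)
    simp [← hw]

lemma SphHolomorphicOn.comp {f : ℂ → OnePoint ℂ} {U V : Set ℂ} {φ : ℂ → ℂ}
    (hf : SphHolomorphicOn f V) (hU : IsOpen U) (hφ : DifferentiableOn ℂ φ U)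
    (hmaps : MapsTo φ U V) : SphHolomorphicOn (f ∘ φ) U := by
  intro z hz
  obtain ⟨W, hW, hzW, h, hh, h1⟩ := hf (φ z) (hmaps hz)
  refine ⟨U ∩ φ ⁻¹' W, hφ.continuousOn.isOpen_inter_preimage hU hW, ⟨hz, hzW⟩, h ∘ φ,
    hh.comp (hφ.mono inter_subset_left) fun w hw => hw.2, ?_⟩
  exact h1.imp (fun H w hw => H _ hw.2) (fun H w hw => H _ hw.2)

lemma SphLocUnifOn.tendsto {F : ℕ → ℂ → OnePoint ℂ} {f : ℂ → OnePoint ℂ} {U : Set ℂ}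
    (h : SphLocUnifOn F f U) {z : ℂ} (hz : z ∈ U) :
    Tendsto (fun n => sphDist (F n z) (f z)) atTop (𝓝 0) := by
  rw [Metric.tendsto_atTop']
  intro ε hε
  obtain ⟨N, hN⟩ := eventually_atTop.1 (h {z} (singleton_subset_iff.2 hz) isCompact_singleton ε hε)
  refine ⟨N, fun n hn => ?_⟩
  rw [Real.dist_0_eq_abs, abs_of_nonneg (sphDist_nonneg _ _)]
  exact hN n hn.le z rfl

lemma tendsto_stereoC {ι : Type*} {l : Filter ι} {c : ι → OnePoint ℂ} {x : OnePoint ℂ}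
    (h : Tendsto (fun n => sphDist (c n) x) l (𝓝 0)) :
    Tendsto (fun n => stereoC (c n)) l (𝓝 (stereoC x)) :=
  tendsto_iff_norm_sub_tendsto_zero.2 <|
    squeeze_zero (fun _ => norm_nonneg _) (fun _ => norm_stereoC_sub_le _ _) h

lemma tendsto_stereoR {ι : Type*} {l : Filter ι} {c : ι → OnePoint ℂ} {x : OnePoint ℂ}
    (h : Tendsto (fun n => sphDist (c n) x) l (𝓝 0)) :
    Tendsto (fun n => stereoR (c n)) l (𝓝 (stereoR x)) :=
  tendsto_iff_norm_sub_tendsto_zero.2 <|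
    squeeze_zero (fun _ => norm_nonneg _) (fun _ => abs_stereoR_sub_le _ _) h

lemma eq_of_tendsto_sphDist {ι : Type*} {l : Filter ι} [l.NeBot] {c : ι → OnePoint ℂ}
    {x y : OnePoint ℂ} (hx : Tendsto (fun n => sphDist (c n) x) l (𝓝 0))
    (hy : Tendsto (fun n => sphDist (c n) y) l (𝓝 0)) : x = y :=
  eq_of_stereo_eq (tendsto_nhds_unique (tendsto_stereoC hx) (tendsto_stereoC hy))
    (tendsto_nhds_unique (tendsto_stereoR hx) (tendsto_stereoR hy))

/-- A spherical limit of complex numbers of norm at most `L` is such a number. -/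
lemma exists_coe_norm_le_of_tendsto {ι : Type*} {l : Filter ι} [l.NeBot] {c : ι → OnePoint ℂ}
    {x : OnePoint ℂ} {L : ℝ} (hL : 0 < L) (h : Tendsto (fun n => sphDist (c n) x) l (𝓝 0))
    (hc : ∀ n, ∃ w : ℂ, c n = w ∧ ‖w‖ < L) : ∃ w : ℂ, x = w ∧ ‖w‖ ≤ L := by
  have hb : 1 / (1 + L ^ 2) ≤ stereoR x := by
    refine ge_of_tendsto' (tendsto_stereoR h) fun n => ?_
    obtain ⟨w, hw, hwL⟩ := hc n
    rw [hw, stereoR_coe]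
    gcongr
  induction x using OnePoint.rec with
  | infty =>
    have : 0 < 1 / (1 + L ^ 2) := by positivity
    rw [stereoR_infty] at hb
    linarith
  | coe w =>
    refine ⟨w, rfl, ?_⟩
    rw [stereoR_coe, one_div_le_one_div (by positivity) (by positivity)] at hb
    exact le_of_sq_le_sq (by linarith) hL.le

lemma PL.comp {L : ℝ} {U V : Set ℂ} {φ : ℂ → ℂ} {f : ℂ → OnePoint ℂ} (hf : PL L V f)
    (hU : IsOpen U) (hφ : DifferentiableOn ℂ φ U) (hmaps : MapsTo φ U V) : PL L U (f ∘ φ) :=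
  ⟨hf.1.comp hU hφ hmaps, hf.2.imp (fun H _ hz => H _ (hmaps hz))
    (fun H _ hz _ hw => H _ (hmaps hz) _ (hmaps hw))⟩

/-- Any three points of a plane domain lie in a common relatively compact subdomain. -/
lemma exists_relatively_compact_subdomain {U : Set ℂ} (hU : IsOpen U) (hc : IsConnected U)
    {x y z : ℂ} (hx : x ∈ U) (hy : y ∈ U) (hz : z ∈ U) :
    ∃ Ω : Set ℂ, IsOpen Ω ∧ IsConnected Ω ∧ IsCompact (closure Ω) ∧ closure Ω ⊆ U ∧
      x ∈ Ω ∧ y ∈ Ω ∧ z ∈ Ω := by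
  have hp : IsPathConnected U := hU.isConnected_iff_isPathConnected.1 hc
  obtain ⟨γ, hγ⟩ := hp.joinedIn x hx y hy
  obtain ⟨η, hη⟩ := hp.joinedIn x hx z hz
  set K : Set ℂ := range γ ∪ range η with hK
  have hKc : IsCompact K := (isCompact_range γ.continuous).union (isCompact_range η.continuous)
  have hKU : K ⊆ U := union_subset (range_subset_iff.2 hγ) (range_subset_iff.2 hη)
  have hxK : x ∈ K := Or.inl ⟨0, γ.source⟩
  have hKconn : IsConnected K :=
    (isConnected_range γ.continuous).union ⟨x, ⟨0, γ.source⟩, ⟨0, η.source⟩⟩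
      (isConnected_range η.continuous)
  obtain ⟨δ, hδ, hδU⟩ := hKc.exists_cthickening_subset_open hU hKU
  have hsub : closure (Metric.thickening δ K) ⊆ Metric.cthickening δ K :=
    Metric.closure_thickening_subset_cthickening δ K
  have hself : K ⊆ Metric.thickening δ K := Metric.self_subset_thickening hδ K
  refine ⟨Metric.thickening δ K, Metric.isOpen_thickening, ?_,
    hKc.cthickening.of_isClosed_subset isClosed_closure hsub, hsub.trans hδU, hself hxK,
    hself (Or.inl ⟨1, γ.target⟩), hself (Or.inr ⟨1, η.target⟩)⟩
  refine ⟨⟨x, hself hxK⟩, isPreconnected_of_forall x fun w hw => ?_⟩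
  obtain ⟨k, hk, hwk⟩ := Metric.mem_thickening_iff.1 hw
  refine ⟨K ∪ Metric.ball k δ, union_subset hself (Metric.ball_subset_thickening hk δ),
    Or.inl hxK, Or.inr hwk, ?_⟩
  exact hKconn.isPreconnected.union k hk (Metric.mem_ball_self hδ)
    (convex_ball k δ).isPreconnected

lemma isClosedProperty_PL {L : ℝ} (hL : 0 < L) : IsClosedProperty (PL L) where
  mem_holo U f _ _ h := h.1
  comp U V φ f hU _ _ _ hφ hmaps _ hf := hf.comp hU hφ hmaps
  exhaust U f hU hUc hf H := by
    refine ⟨hf, or_iff_not_imp_right.2 fun hnc p hp => ?_⟩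
    push Not at hnc
    obtain ⟨z, hz, w, hw, hzw⟩ := hnc
    obtain ⟨Ω, hΩ, hΩc, hΩk, hΩU, hpΩ, hzΩ, hwΩ⟩ :=
      exists_relatively_compact_subdomain hU hUc hp hz hw
    rcases (H Ω hΩ hΩc hΩk hΩU).2 with h | h
    · exact h p hpΩ
    · exact absurd (h z hzΩ w hwΩ) hzw
  closed U f F hU hUc hF hlim hf := by
    refine ⟨hf, ?_⟩
    by_cases hfreq : ∃ᶠ n in atTop, ∀ z ∈ U, ∃ w : ℂ, F n z = w ∧ ‖w‖ < L
    · obtain ⟨φ, hφ, hφF⟩ := extraction_of_frequently_atTop hfreq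
      have hle : ∀ z ∈ U, ∃ w : ℂ, f z = w ∧ ‖w‖ ≤ L := fun z hz =>
        exists_coe_norm_le_of_tendsto hL ((hlim.tendsto hz).comp hφ.tendsto_atTop)
          fun n => hφF n z hz
      obtain ⟨h, hh, hfh⟩ := hf.exists_eq_coe fun z hz => by
        obtain ⟨w, hw, -⟩ := hle z hz
        simp [hw]
      have hhL : ∀ z ∈ U, ‖h z‖ ≤ L := fun z hz => by
        obtain ⟨w, hw, hwL⟩ := hle z hz
        rwa [OnePoint.coe_injective ((hfh z hz).symm.trans hw)]
      by_cases hmax : ∃ c ∈ U, ‖h c‖ = L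
      · obtain ⟨c, hcU, hc⟩ := hmax
        have heq := Complex.eqOn_of_isPreconnected_of_isMaxOn_norm hUc.isPreconnected hU hh hcU
          fun z hz => by simpa [hc] using hhL z hz
        refine Or.inr fun z hz w hw => ?_
        rw [hfh z hz, hfh w hw, heq hz, heq hw]
        rfl
      · push Not at hmax
        exact Or.inl fun z hz => ⟨h z, hfh z hz, (hhL z hz).lt_of_ne (hmax z hz)⟩
    · obtain ⟨N, hN⟩ := eventually_atTop.1 (not_frequently.1 hfreq)
      refine Or.inr fun z hz w hw => ?_
      refine eq_of_tendsto_sphDist (hlim.tendsto hz)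
        ((hlim.tendsto hw).congr' ?_)
      filter_upwards [eventually_ge_atTop N] with n hn
      rw [((hF n).2.resolve_left (hN n hn)) z hz w hw]

/-- The Riemann sphere is sequentially compact for the chordal distance. -/
lemma exists_subseq_tendsto_sphDist (c : ℕ → OnePoint ℂ) :
    ∃ φ : ℕ → ℕ, StrictMono φ ∧ ∃ x, Tendsto (fun n => sphDist (c (φ n)) x) atTop (𝓝 0) := by
  by_cases hB : ∃ B : ℝ, ∃ᶠ n in atTop, ∃ w : ℂ, c n = w ∧ ‖w‖ ≤ B
  · obtain ⟨B, hB⟩ := hB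
    obtain ⟨φ, hφ, hφc⟩ := extraction_of_frequently_atTop hB
    choose w hw hwB using hφc
    obtain ⟨a, -, ψ, hψ, hlim⟩ := (isCompact_closedBall (0 : ℂ) B).tendsto_subseq
      (x := w) (fun n => by simpa using hwB n)
    refine ⟨φ ∘ ψ, hφ.comp hψ, a, squeeze_zero (fun _ => sphDist_nonneg _ _) (fun n => ?_)
      (tendsto_iff_norm_sub_tendsto_zero.1 hlim)⟩
    simp only [Function.comp_apply, hw]
    exact sphDist_coe_coe_le _ _
  · push Not at hB
    refine ⟨id, strictMono_id, OnePoint.infty, ?_⟩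
    rw [Metric.tendsto_atTop']
    intro ε hε
    obtain ⟨N, hN⟩ := eventually_atTop.1 (hB (1 / ε))
    refine ⟨N, fun n hn => ?_⟩
    rw [Real.dist_0_eq_abs, abs_of_nonneg (sphDist_nonneg _ _), id]
    cases hcn : c n using OnePoint.rec with
    | infty => simpa using hε
    | coe w =>
      have hw := hN n hn.le w hcn
      rw [sphDist_coe_infty, div_lt_comm₀ (by positivity) hε]
      refine Real.lt_sqrt_of_sq_lt ?_
      have := pow_lt_pow_left₀ hw (by positivity) two_ne_zero
      linarith

/-- **Montel's theorem** for uniformly bounded sequences of holomorphic functions. -/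
lemma montel {U : Set ℂ} (hU : IsOpen U) {L : ℝ} {h : ℕ → ℂ → ℂ}
    (hd : ∀ n, DifferentiableOn ℂ (h n) U) (hb : ∀ n, ∀ z ∈ U, ‖h n z‖ ≤ L) :
    ∃ φ : ℕ → ℕ, StrictMono φ ∧ ∃ g : ℂ → ℂ, ∀ K ⊆ U, IsCompact K →
      TendstoUniformlyOn (fun n => h (φ n)) g atTop K := by
  have : LocallyCompactSpace U := hU.locallyCompactSpace
  let T : Set (U → ℂ) := {u | (∀ x, u x ∈ Metric.closedBall 0 L) ∧
    ∀ x : U, ∀ r : ℝ, Metric.ball (x : ℂ) r ⊆ U → ∀ y : U, (y : ℂ) ∈ Metric.ball (x : ℂ) r →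
      dist (u y) (u x) ≤ 2 * L / r * dist y x}
  let S : Set C(U, ℂ) := {u | ⇑u ∈ T}
  have hT_equi : Equicontinuous ((↑) : T → U → ℂ) := by
    intro x
    obtain ⟨r, hr, hrU⟩ := Metric.isOpen_iff.1 hU x x.2
    refine Metric.equicontinuousAt_of_continuity_modulus (fun y => 2 * L / r * dist y x) ?_ _ ?_
    · have : Continuous fun y : U => 2 * L / r * dist y x := by fun_prop
      simpa using this.tendsto x
    · filter_upwards [Metric.ball_mem_nhds x hr] with y hy u
      rw [dist_comm]
      exact u.2.2 x r hrU y hy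
  have hT_closed : IsClosed T := by
    have : T = (⋂ x : U, {u | u x ∈ Metric.closedBall 0 L}) ∩
        ⋂ (x : U) (r : ℝ) (_ : Metric.ball (x : ℂ) r ⊆ U) (y : U)
          (_ : (y : ℂ) ∈ Metric.ball (x : ℂ) r),
          {u : U → ℂ | dist (u y) (u x) ≤ 2 * L / r * dist y x} := by
      ext u; simp [T]
    rw [this]
    refine (isClosed_iInter fun x => Metric.isClosed_closedBall.preimage (continuous_apply x)).inter
      (isClosed_iInter fun x => isClosed_iInter fun r => isClosed_iInter fun _ =>
        isClosed_iInter fun y => isClosed_iInter fun _ => isClosed_le ?_ continuous_const)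
    exact (continuous_apply y).dist (continuous_apply x)
  have hT : IsCompact T :=
    (isCompact_univ_pi fun _ : U => isCompact_closedBall (0 : ℂ) L).of_isClosed_subset hT_closed
      fun u hu x _ => hu.1 x
  have hS : IsCompact S := by
    refine ArzelaAscoli.isCompact_of_equicontinuous S ?_ ?_
    · convert hT
      ext u
      refine ⟨fun ⟨v, hv, hvu⟩ => hvu ▸ hv, fun hu => ⟨⟨u, hT_equi.continuous ⟨u, hu⟩⟩, hu, rfl⟩⟩
    · exact hT_equi.comp fun u : S => (⟨u.1, u.2⟩ : T)
  let v : ℕ → C(U, ℂ) := fun n => ⟨U.domRestrict (h n), (hd n).continuousOn.domRestrict⟩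
  have hv : ∀ n, v n ∈ S := by
    intro n
    refine ⟨fun x => mem_closedBall_zero_iff.2 (hb n x x.2), fun x r hr y hy => ?_⟩
    refine Complex.dist_le_div_mul_dist_of_mapsTo_ball ((hd n).mono hr) (fun z hz => ?_) hy
    rw [Metric.mem_closedBall, dist_eq_norm]
    have := norm_sub_le (h n z) (h n x)
    linarith [hb n z (hr hz), hb n x x.2]
  classical
  obtain ⟨g, -, φ, hφ, hlim⟩ := hS.tendsto_subseq hv
  refine ⟨φ, hφ, fun z => if hz : z ∈ U then g ⟨z, hz⟩ else 0, fun K hKU hK => ?_⟩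
  rw [ContinuousMap.tendsto_iff_forall_isCompact_tendstoUniformlyOn] at hlim
  have hK' : IsCompact ((↑) ⁻¹' K : Set U) :=
    Topology.IsInducing.subtypeVal.isCompact_preimage' hK (by simpa using hKU)
  have := hlim _ hK'
  rw [Metric.tendstoUniformlyOn_iff] at this ⊢
  intro ε hε
  filter_upwards [this ε hε] with n hn z hz
  simpa [hKU hz, v] using hn ⟨z, hKU hz⟩ hz

lemma isCompactProperty_PL {L : ℝ} (hL : 0 < L) : IsCompactProperty (PL L) where
  toIsClosedProperty := isClosedProperty_PL hL
  normal U hU hUc F hF := by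
    by_cases hfreq : ∃ᶠ n in atTop, ∀ z ∈ U, ∃ w : ℂ, F n z = w ∧ ‖w‖ < L
    · obtain ⟨φ, hφ, hφF⟩ := extraction_of_frequently_atTop hfreq
      have hex : ∀ n, ∃ h : ℂ → ℂ, DifferentiableOn ℂ h U ∧ ∀ z ∈ U, F (φ n) z = h z :=
        fun n => (hF (φ n)).1.exists_eq_coe fun z hz => by
          obtain ⟨w, hw, -⟩ := hφF n z hz
          simp [hw]
      choose h hh hFh using hex
      have hhL : ∀ n, ∀ z ∈ U, ‖h n z‖ ≤ L := fun n z hz => by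
        obtain ⟨w, hw, hwL⟩ := hφF n z hz
        rw [OnePoint.coe_injective ((hFh n z hz).symm.trans hw)]
        exact hwL.le
      obtain ⟨ψ, hψ, g, hg⟩ := montel hU hh hhL
      refine ⟨φ ∘ ψ, hφ.comp hψ, fun z => g z, fun K hKU hK ε hε => ?_⟩
      filter_upwards [Metric.tendstoUniformlyOn_iff.1 (hg K hKU hK) ε hε] with n hn z hz
      simp only [Function.comp_apply]
      rw [hFh _ z (hKU hz)]
      refine (sphDist_coe_coe_le _ _).trans_lt ?_
      rw [← dist_eq_norm, dist_comm]
      exact hn z hz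
    · obtain ⟨N, hN⟩ := eventually_atTop.1 (not_frequently.1 hfreq)
      obtain ⟨p, hp⟩ := hUc.nonempty
      obtain ⟨φ, hφ, x, hx⟩ := exists_subseq_tendsto_sphDist fun n => F n p
      refine ⟨φ, hφ, fun _ => x, fun K hKU hK ε hε => ?_⟩
      filter_upwards [hx.eventually_lt_const hε, hφ.tendsto_atTop.eventually_ge_atTop N]
        with n hn hnN z hz
      simp only [Function.comp_apply]
      rwa [(hF (φ n)).2.resolve_left (hN _ hnN) z (hKU hz) p hp]

/-- `G` solves `G' = 1 / f(G)` on `Ω` with values in `U`, i.e. it is a local isometry from the flat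
set `Ω` to `U` with the metric `|f| |dz|`. -/
def IsFlatChart (f : ℂ → ℂ) (U Ω : Set ℂ) (G : ℂ → ℂ) : Prop :=
  ∀ w ∈ Ω, G w ∈ U ∧ HasDerivAt G (f (G w))⁻¹ w

lemma IsFlatChart.mono {f G : ℂ → ℂ} {U Ω Ω' : Set ℂ} (h : IsFlatChart f U Ω G) (hsub : Ω' ⊆ Ω) :
    IsFlatChart f U Ω' G := fun w hw => h w (hsub hw)

lemma IsFlatChart.congr {f G H : ℂ → ℂ} {U Ω : Set ℂ} (h : IsFlatChart f U Ω G) (hΩ : IsOpen Ω)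
    (heq : EqOn H G Ω) : IsFlatChart f U Ω H := fun w hw => by
  rw [heq hw]
  exact ⟨(h w hw).1, (h w hw).2.congr_of_eventuallyEq (heq.eventuallyEq_of_mem (hΩ.mem_nhds hw))⟩

lemma IsFlatChart.differentiableOn {f G : ℂ → ℂ} {U Ω : Set ℂ} (h : IsFlatChart f U Ω G) :
    DifferentiableOn ℂ G Ω := fun w hw => (h w hw).2.differentiableAt.differentiableWithinAt

section FlatChart

variable {f : ℂ → ℂ} {U : Set ℂ}

/-- A nonvanishing holomorphic function has, locally, a biholomorphic primitive. -/
lemma exists_local_primitive (hU : IsOpen U) (hf : DifferentiableOn ℂ f U)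
    (hf0 : ∀ z ∈ U, f z ≠ 0) {q : ℂ} (hq : q ∈ U) :
    ∃ e : OpenPartialHomeomorph ℂ ℂ, q ∈ e.source ∧ e.source ⊆ U ∧
      ∀ z ∈ e.source, HasDerivAt e (f z) z := by
  obtain ⟨r, hr, hrU⟩ := Metric.isOpen_iff.1 hU q hq
  obtain ⟨F, hF⟩ := (hf.mono hrU).isExactOn_ball
  have hFd : DifferentiableOn ℂ F (Metric.ball q r) :=
    fun z hz => (hF z hz).differentiableAt.differentiableWithinAt
  have hst : HasStrictDerivAt F (f q) q := by
    have := (hFd.analyticAt (Metric.ball_mem_nhds q hr)).hasStrictDerivAt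
    rwa [(hF q (Metric.mem_ball_self hr)).deriv] at this
  have hst' := hst.hasStrictFDerivAt_equiv (hf0 q hq)
  let e := hst'.toOpenPartialHomeomorph F
  refine ⟨e.restrOpen (Metric.ball q r) Metric.isOpen_ball,
    ⟨hst'.mem_toOpenPartialHomeomorph_source, Metric.mem_ball_self hr⟩,
    fun z hz => hrU hz.2, fun z hz => hF z hz.2⟩

/-- Flat charts exist on discs of locally uniform radius. -/
lemma exists_flatChart_ball (hU : IsOpen U) (hf : DifferentiableOn ℂ f U)
    (hf0 : ∀ z ∈ U, f z ≠ 0) {q₀ : ℂ} (hq₀ : q₀ ∈ U) :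
    ∃ δ > 0, ∀ᶠ q in 𝓝 q₀, ∀ w₀ : ℂ, ∃ H : ℂ → ℂ, H w₀ = q ∧
      IsFlatChart f U (Metric.ball w₀ δ) H := by
  obtain ⟨e, heq, heU, hed⟩ := exists_local_primitive hU hf hf0 hq₀
  obtain ⟨ε, hε, hεt⟩ := Metric.isOpen_iff.1 e.open_target (e q₀) (e.map_source heq)
  refine ⟨ε / 2, half_pos hε, ?_⟩
  filter_upwards [e.open_source.mem_nhds heq,
    (e.continuousAt heq).eventually (Metric.ball_mem_nhds _ (half_pos hε))] with q hq hqε w₀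
  refine ⟨fun w => e.symm (e q + (w - w₀)), by simp [e.left_inv hq], fun w hw => ?_⟩
  have hmem : e q + (w - w₀) ∈ e.target := by
    refine hεt ?_
    rw [Metric.mem_ball, dist_eq_norm] at *
    have := norm_add_le (e q - e q₀) (w - w₀)
    rw [show e q + (w - w₀) - e q₀ = e q - e q₀ + (w - w₀) by ring]
    linarith
  have hs := e.map_target hmem
  refine ⟨heU hs, ?_⟩
  have h1 := e.hasDerivAt_symm hmem (hf0 _ (heU hs)) (hed _ hs)
  have h2 : HasDerivAt (fun w => e q + (w - w₀)) 1 w :=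
    ((hasDerivAt_id w).sub_const w₀).const_add (e q)
  have h3 := h1.comp w h2
  rw [mul_one] at h3
  exact h3

/-- Flat charts on a connected set are determined by their value at one point. -/
lemma IsFlatChart.eqOn (hU : IsOpen U) (hf : DifferentiableOn ℂ f U)
    (hf0 : ∀ z ∈ U, f z ≠ 0) {Ω : Set ℂ} (hΩ : IsOpen Ω) (hΩc : IsPreconnected Ω) {G H : ℂ → ℂ}
    (hG : IsFlatChart f U Ω G) (hH : IsFlatChart f U Ω H) {w₀ : ℂ} (hw₀ : w₀ ∈ Ω)
    (h0 : G w₀ = H w₀) : EqOn G H Ω := by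
  refine (hG.differentiableOn.analyticOnNhd hΩ).eqOn_of_preconnected_of_eventuallyEq
    (hH.differentiableOn.analyticOnNhd hΩ) hΩc hw₀ ?_
  obtain ⟨e, heq, heU, hed⟩ := exists_local_primitive hU hf hf0 (hG w₀ hw₀).1
  have hGs := (hG w₀ hw₀).2.continuousAt.eventually (e.open_source.mem_nhds heq)
  have hHs := (hH w₀ hw₀).2.continuousAt.eventually (e.open_source.mem_nhds (h0 ▸ heq))
  obtain ⟨r, hr, hrs⟩ := Metric.eventually_nhds_iff_ball.1 ((hGs.and hHs).and (hΩ.mem_nhds hw₀))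
  have hder : ∀ K : ℂ → ℂ, IsFlatChart f U Ω K → ∀ w ∈ Ω, K w ∈ e.source →
      HasDerivAt (fun w => e (K w)) 1 w := fun K hK w hw hKs => by
    have := (hed _ hKs).comp w (hK w hw).2
    rwa [mul_inv_cancel₀ (hf0 _ (hK w hw).1)] at this
  have hsub : ∀ w ∈ Metric.ball w₀ r, HasDerivAt (fun w => e (G w) - e (H w)) 0 w :=
    fun w hw => by
      obtain ⟨⟨h1, h2⟩, h3⟩ := hrs w hw
      simpa only [sub_self] using (hder G hG w h3 h1).fun_sub (hder H hH w h3 h2)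
  filter_upwards [Metric.ball_mem_nhds w₀ hr] with w hw
  have hconst := Metric.isOpen_ball.is_const_of_deriv_eq_zero (convex_ball w₀ r).isPreconnected
    (fun w hw => (hsub w hw).differentiableAt.differentiableWithinAt)
    (fun w hw => (hsub w hw).deriv) hw (Metric.mem_ball_self hr)
  simp only [h0, sub_self] at hconst
  exact e.injOn (hrs w hw).1.1 (hrs w hw).1.2 (sub_eq_zero.1 hconst)

/-- The flat charts on convex neighbourhoods of `0` sending `0` to `p` glue to a maximal one. -/
lemma exists_maximal_flatChart (hU : IsOpen U) (hf : DifferentiableOn ℂ f U)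
    (hf0 : ∀ z ∈ U, f z ≠ 0) {p : ℂ} (hp : p ∈ U) :
    ∃ (D : Set ℂ) (G : ℂ → ℂ), IsOpen D ∧ 0 ∈ D ∧ IsFlatChart f U D G ∧ G 0 = p ∧
      (∀ w ∈ D, ∃ Ω ⊆ D, IsOpen Ω ∧ Convex ℝ Ω ∧ 0 ∈ Ω ∧ w ∈ Ω) ∧
      ∀ (Ω : Set ℂ) (H : ℂ → ℂ), IsOpen Ω → Convex ℝ Ω → 0 ∈ Ω → IsFlatChart f U Ω H →
        H 0 = p → Ω ⊆ D := by
  let P : Set ℂ → (ℂ → ℂ) → Prop := fun Ω H =>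
    IsOpen Ω ∧ Convex ℝ Ω ∧ 0 ∈ Ω ∧ IsFlatChart f U Ω H ∧ H 0 = p
  let D : Set ℂ := {w | ∃ Ω H, P Ω H ∧ w ∈ Ω}
  have hsub : ∀ Ω H, P Ω H → Ω ⊆ D := fun Ω H h w hw => ⟨Ω, H, h, hw⟩
  have hex : ∀ w : ℂ, ∃ H : ℂ → ℂ, w ∈ D → ∃ Ω, P Ω H ∧ w ∈ Ω := fun w => by
    by_cases hw : w ∈ D
    · obtain ⟨Ω, H, h⟩ := hw
      exact ⟨H, fun _ => ⟨Ω, h⟩⟩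
    · exact ⟨0, fun h => absurd h hw⟩
  choose H hH using hex
  have heq : ∀ Ω K, P Ω K → EqOn (fun w => H w w) K Ω := fun Ω K hK w hw => by
    obtain ⟨Ω', h', hw'⟩ := hH w (hsub Ω K hK hw)
    exact IsFlatChart.eqOn hU hf hf0 (h'.1.inter hK.1) (h'.2.1.inter hK.2.1).isPreconnected
      (h'.2.2.2.1.mono inter_subset_left) (hK.2.2.2.1.mono inter_subset_right)
      ⟨h'.2.2.1, hK.2.2.1⟩ (h'.2.2.2.2.trans hK.2.2.2.2.symm) ⟨hw', hw⟩
  obtain ⟨δ, hδ, hloc⟩ := exists_flatChart_ball hU hf hf0 hp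
  obtain ⟨K₀, hK₀, hK₀'⟩ := hloc.self_of_nhds 0
  have hP₀ : P (Metric.ball 0 δ) K₀ :=
    ⟨Metric.isOpen_ball, convex_ball _ _, Metric.mem_ball_self hδ, hK₀', hK₀⟩
  refine ⟨D, fun w => H w w, ?_, hsub _ _ hP₀ (Metric.mem_ball_self hδ), ?_, ?_, ?_, ?_⟩
  · refine isOpen_iff_mem_nhds.2 fun w ⟨Ω, K, hK, hw⟩ => ?_
    exact mem_of_superset (hK.1.mem_nhds hw) (hsub Ω K hK)
  · rintro w ⟨Ω, K, hK, hw⟩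
    exact hK.2.2.2.1.congr hK.1 (heq Ω K hK) w hw
  · exact (heq _ _ hP₀ (Metric.mem_ball_self hδ)).trans hK₀
  · rintro w ⟨Ω, K, hK, hw⟩
    exact ⟨Ω, hsub Ω K hK, hK.1, hK.2.1, hK.2.2.1, hw⟩
  · exact fun Ω K h1 h2 h3 h4 h5 => hsub Ω K ⟨h1, h2, h3, h4, h5⟩

/-- A flat chart on a convex set extends to a convex set containing the segment `[0, a]`, provided
that it agrees at a point `s a` with a flat chart on a disc containing the rest of the segment. -/
lemma IsFlatChart.exists_extension (hU : IsOpen U) (hf : DifferentiableOn ℂ f U)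
    (hf0 : ∀ z ∈ U, f z ≠ 0) {Ω : Set ℂ} {G H : ℂ → ℂ} {a : ℂ} {s δ : ℝ} (hΩ : IsOpen Ω)
    (hΩc : Convex ℝ Ω) (hΩ0 : 0 ∈ Ω) (hG : IsFlatChart f U Ω G)
    (hH : IsFlatChart f U (Metric.ball (s • a) δ) H) (hs0 : 0 ≤ s) (hs1 : s < 1) (hs : s • a ∈ Ω)
    (heq : H (s • a) = G (s • a)) (ha : (1 - s) * ‖a‖ < δ) :
    ∃ V K, IsOpen V ∧ Convex ℝ V ∧ 0 ∈ V ∧ a ∈ V ∧ IsFlatChart f U V K ∧ K 0 = G 0 := by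
  have hδ : 0 < δ := lt_of_le_of_lt (mul_nonneg (by linarith) (norm_nonneg a)) ha
  have hseg : segment ℝ 0 a ⊆ Ω ∪ Metric.ball (s • a) δ := by
    rw [segment_eq_image]
    rintro _ ⟨t, ⟨ht0, ht1⟩, rfl⟩
    simp only [smul_zero, zero_add]
    rcases le_total t s with hts | hts
    · left
      rcases hs0.eq_or_lt with h | h
      · rw [le_antisymm (h ▸ hts) ht0, zero_smul]
        exact hΩ0
      · have := hΩc.smul_mem_of_zero_mem hΩ0 hs (t := t / s)
          ⟨by positivity, (div_le_one h).2 hts⟩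
        rwa [smul_smul, div_mul_cancel₀ _ h.ne'] at this
    · right
      rw [Metric.mem_ball, dist_eq_norm, ← sub_smul, norm_smul, Real.norm_of_nonneg (by linarith)]
      refine lt_of_le_of_lt ?_ ha
      gcongr
  have hcomp : IsCompact (segment ℝ (0 : ℂ) a) := by
    rw [segment_eq_image]
    exact isCompact_Icc.image (by fun_prop)
  obtain ⟨ε, hε, hεsub⟩ := hcomp.exists_thickening_subset_open (hΩ.union Metric.isOpen_ball) hseg
  have hself := Metric.self_subset_thickening hε (segment ℝ (0 : ℂ) a)
  have hHG : EqOn H G (Ω ∩ Metric.ball (s • a) δ) :=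
    IsFlatChart.eqOn hU hf hf0 (hΩ.inter Metric.isOpen_ball)
      (hΩc.inter (convex_ball _ _)).isPreconnected (hH.mono inter_subset_right)
      (hG.mono inter_subset_left) ⟨hs, Metric.mem_ball_self hδ⟩ heq
  classical
  refine ⟨Metric.thickening ε (segment ℝ 0 a), Ω.piecewise G H, Metric.isOpen_thickening,
    (convex_segment 0 a).thickening ε, hself (left_mem_segment ℝ 0 a),
    hself (right_mem_segment ℝ 0 a), fun w hw => ?_, by simp [hΩ0]⟩
  rcases hεsub hw with h | h
  · exact hG.congr hΩ (piecewise_eqOn Ω G H) w h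
  · refine hH.congr Metric.isOpen_ball (fun z hz => ?_) w h
    by_cases hzΩ : z ∈ Ω
    · simp [hzΩ, hHG ⟨hzΩ, hz⟩]
    · simp [hzΩ]

end FlatChart

/-- A maximal flat chart at `p` leaves every compact set along a ray leaving its domain. -/
lemma exists_maximal_flatChart_divergent {f : ℂ → ℂ} {U : Set ℂ} (hU : IsOpen U)
    (hf : DifferentiableOn ℂ f U) (hf0 : ∀ z ∈ U, f z ≠ 0) {p : ℂ} (hp : p ∈ U) :
    ∃ (D : Set ℂ) (G : ℂ → ℂ), IsOpen D ∧ 0 ∈ D ∧ IsFlatChart f U D G ∧ G 0 = p ∧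
      ∀ a ∉ D, (∀ t ∈ Ico (0 : ℝ) 1, t • a ∈ D) → ∀ K : Set ℂ, IsCompact K → K ⊆ U →
        ∃ t₀ ∈ Ico (0 : ℝ) 1, ∀ t, t₀ ≤ t → t < 1 → G (t • a) ∉ K := by
  obtain ⟨D, G, hD, h0D, hG, hG0, hconv, hmax⟩ := exists_maximal_flatChart hU hf hf0 hp
  refine ⟨D, G, hD, h0D, hG, hG0, fun a ha hray K hK hKU => ?_⟩
  by_contra! hdiv
  have hfreq : ∃ᶠ t in 𝓝[<] (1 : ℝ), G (t • a) ∈ K := by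
    intro hev
    obtain ⟨l, hl, hlK⟩ := (mem_nhdsLT_iff_exists_mem_Ico_Ioo_subset zero_lt_one).1 hev
    obtain ⟨t, ht, ht1, htK⟩ := hdiv ((l + 1) / 2) ⟨by linarith [hl.1], by linarith [hl.2]⟩
    exact hlK ⟨by linarith [hl.2], ht1⟩ htK
  obtain ⟨q, hqK, hq⟩ := hK.exists_mapClusterPt_of_frequently hfreq
  obtain ⟨δ, hδ, hloc⟩ := exists_flatChart_ball hU hf hf0 (hKU hqK)
  have hnear : ∀ᶠ t in 𝓝[<] (1 : ℝ), (1 - t) * ‖a‖ < δ := by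
    have hcont : Continuous fun t : ℝ => (1 - t) * ‖a‖ := by fun_prop
    exact nhdsWithin_le_nhds (hcont.continuousAt.eventually_lt_const (by simpa using hδ))
  obtain ⟨t, hloct, hδt, ht⟩ := ((hq.frequently hloc).and_eventually
    (hnear.and (Ico_mem_nhdsLT zero_lt_one))).exists
  obtain ⟨H, hHt, hH⟩ := hloct (t • a)
  obtain ⟨Ω, hΩD, hΩ, hΩc, hΩ0, htΩ⟩ := hconv _ (hray t ht)
  obtain ⟨V, E, hV, hVc, h0V, haV, hE, hE0⟩ :=
    (hG.mono hΩD).exists_extension hU hf hf0 hΩ hΩc hΩ0 hH ht.1 ht.2 htΩ hHt hδt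
  exact ha (hmax V E hV hVc h0V hE (hE0.trans hG0) haV)

/-- An open set containing `0` but not `a` has a first boundary point on the ray to `a`. -/
lemma exists_first_exit {D : Set ℂ} (hD : IsOpen D) (h0 : 0 ∈ D) {a : ℂ} (ha : a ∉ D) :
    ∃ b ∉ D, ‖b‖ ≤ ‖a‖ ∧ ∀ t ∈ Ico (0 : ℝ) 1, t • b ∈ D := by
  let S : Set ℝ := {t | t ∈ Icc 0 1 ∧ t • a ∉ D}
  have hS : IsCompact S := isCompact_Icc.inter_right
    (hD.isClosed_compl.preimage (by fun_prop : Continuous fun t : ℝ => t • a))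
  obtain ⟨s, hs, hmin⟩ := hS.exists_isLeast ⟨1, ⟨zero_le_one, le_rfl⟩, by simpa using ha⟩
  refine ⟨s • a, hs.2, ?_, fun t ht => ?_⟩
  · rw [norm_smul, Real.norm_of_nonneg hs.1.1]
    exact mul_le_of_le_one_left (norm_nonneg a) hs.1.2
  · have hs0 : 0 < s := hs.1.1.lt_of_ne fun h => hs.2 (by simpa [← h] using h0)
    by_contra hmem
    rw [smul_smul] at hmem
    have := hmin ⟨⟨by have := ht.1; positivity, by nlinarith [hs.1.2, ht.2]⟩, hmem⟩
    nlinarith [ht.2]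

/-- If divergent paths from `p` have `lam`-length at least `C R`, where `lam ≤ C |f|`, then `p` is
the centre of a flat disc of radius `R`. -/
lemma exists_flatChart_of_le_distToBdry {f : ℂ → ℂ} {lam : ℂ → ℝ} {U : Set ℂ} (hU : IsOpen U)
    (hf : DifferentiableOn ℂ f U) (hf0 : ∀ z ∈ U, f z ≠ 0) {C : ℝ} (hC : 0 < C)
    (hlam : ∀ z ∈ U, lam z ≤ C * ‖f z‖) {p : ℂ} (hp : p ∈ U) {R : ℝ}
    (hR : ENNReal.ofReal (C * R) ≤ distToBdry lam U p) :
    ∃ G : ℂ → ℂ, G 0 = p ∧ IsFlatChart f U (Metric.ball 0 R) G := by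
  obtain ⟨D, G, hD, h0D, hG, hG0, hdiv⟩ := exists_maximal_flatChart_divergent hU hf hf0 hp
  refine ⟨G, hG0, hG.mono fun a haR => ?_⟩
  by_contra ha
  obtain ⟨b, hb, hba, hray⟩ := exists_first_exit hD h0D ha
  have hpath : ∀ t ∈ Ico (0 : ℝ) 1, HasDerivAt (fun t : ℝ => G (t • b)) ((f (G (t • b)))⁻¹ * b) t :=
    fun t ht => by
      have h1 : HasDerivAt (fun t : ℝ => t • b) b t := by
        simpa using (hasDerivAt_id t).smul_const b
      exact (hG _ (hray t ht)).2.comp t h1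
  let γ : DivergentPath U p :=
    { toFun := fun t => G (t • b)
      start := by simpa using hG0
      mem := fun t ht => (hG _ (hray t ht)).1
      cont := fun t ht => (hpath t ht).continuousAt.continuousWithinAt
      diff := fun t ht => (hpath t ⟨ht.1.le, ht.2⟩).differentiableAt
      divergent := hdiv b hb hray }
  have hlen : pathLen lam γ.toFun ≤ ENNReal.ofReal (C * ‖b‖) := by
    calc pathLen lam γ.toFun ≤ ∫⁻ _ in Ioo (0 : ℝ) 1, ENNReal.ofReal (C * ‖b‖) := by
          refine setLIntegral_mono measurable_const fun t ht => ENNReal.ofReal_le_ofReal ?_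
          have ht' : t ∈ Ico (0 : ℝ) 1 := ⟨ht.1.le, ht.2⟩
          have hmem := (hG _ (hray t ht')).1
          have hne := norm_pos_iff.2 (hf0 _ hmem)
          change lam (G (t • b)) * ‖deriv (fun t : ℝ => G (t • b)) t‖ ≤ _
          rw [(hpath t ht').deriv, norm_mul, norm_inv]
          calc lam (G (t • b)) * (‖f (G (t • b))‖⁻¹ * ‖b‖)
              ≤ C * ‖f (G (t • b))‖ * (‖f (G (t • b))‖⁻¹ * ‖b‖) := by
                gcongr
                exact hlam _ hmem
            _ = C * ‖b‖ := by field_simp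
      _ = ENNReal.ofReal (C * ‖b‖) := by simp
  have hlt : C * ‖b‖ < C * R :=
    mul_lt_mul_of_pos_left (hba.trans_lt (mem_ball_zero_iff.1 haR)) hC
  have := (hR.trans (iInf_le _ γ)).trans hlen
  rw [ENNReal.ofReal_le_ofReal_iff (by positivity)] at this
  linarith

lemma sphD_coe {h : ℂ → ℂ} {h' z : ℂ} (hh : HasDerivAt h h' z) {g : ℂ → OnePoint ℂ}
    (hg : ∀ᶠ w in 𝓝 z, g w = h w) : sphD g z = ‖h'‖ / (1 + ‖h z‖ ^ 2) := by
  refine Tendsto.limUnder_eq ?_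
  have hz : 0 < 1 + ‖h z‖ ^ 2 := by positivity
  have h1 : Tendsto (fun w => ‖h w - h z‖ / ‖w - z‖) (𝓝[≠] z) (𝓝 ‖h'‖) := by
    refine (hasDerivAt_iff_tendsto_slope.1 hh).norm.congr fun w => ?_
    rw [slope_def_field, norm_div]
  have h2 : Tendsto (fun w => Real.sqrt (1 + ‖h w‖ ^ 2) * Real.sqrt (1 + ‖h z‖ ^ 2)) (𝓝[≠] z)
      (𝓝 (1 + ‖h z‖ ^ 2)) := by
    have hc : ContinuousAt (fun w => Real.sqrt (1 + ‖h w‖ ^ 2) * Real.sqrt (1 + ‖h z‖ ^ 2)) z := by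
      have := hh.continuousAt
      fun_prop
    have := hc.tendsto
    rw [Real.mul_self_sqrt hz.le] at this
    exact this.mono_left nhdsWithin_le_nhds
  refine (h1.div h2 hz.ne').congr' ?_
  filter_upwards [nhdsWithin_le_nhds hg] with w hw
  rw [hw, hg.self_of_nhds, sphDist_coe_coe, Pi.div_apply, div_right_comm]

lemma sphD_of_eventually_eq {g : ℂ → OnePoint ℂ} {z : ℂ} (hg : ∀ᶠ w in 𝓝 z, g w = g z) :
    sphD g z = 0 := by
  refine Tendsto.limUnder_eq (tendsto_const_nhds.congr' ?_)
  filter_upwards [nhdsWithin_le_nhds hg] with w hw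
  rw [hw, sphDist_self, zero_div]

namespace WeierstrassTriple

variable {m : ℕ} {U : Set ℂ}

lemma sqrt_abs_curv (T : WeierstrassTriple m U) {z : ℂ} (hz : z ∈ U) :
    Real.sqrt |T.curv z| = Real.sqrt (2 * m) * (|sphD T.g z| / T.lam z) := by
  have hlam := T.lam_pos z hz
  rw [curv, show -(2 * (m : ℝ)) * sphD T.g z ^ 2 / T.lam z ^ 2 =
    -(2 * m * (sphD T.g z / T.lam z) ^ 2) by ring, abs_neg,
    abs_of_nonneg (by positivity), Real.sqrt_mul (by positivity), Real.sqrt_sq_eq_abs, abs_div,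
    abs_of_pos hlam]

/-- The curvature estimate on a metric disc of radius `(1 + L²)^{m/2} R`, for `|g| < L`. -/
lemma sqrt_abs_curv_mul_le (T : WeierstrassTriple m U) {L : ℝ}
    (hg : ∀ z ∈ U, ∃ w : ℂ, T.g z = w ∧ ‖w‖ < L) {p : ℂ} (hp : p ∈ U) {R : ℝ} (hR : 0 < R)
    (hdist : ENNReal.ofReal ((1 + L ^ 2) ^ ((m : ℝ) / 2) * R) ≤ distToBdry T.lam U p) :
    Real.sqrt |T.curv p| * R ≤ Real.sqrt (2 * m) * (2 * L) := by
  obtain ⟨h, hh, hgh⟩ := T.g_holo.exists_eq_coe fun z hz => by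
    obtain ⟨w, hw, -⟩ := hg z hz
    simp [hw]
  have hhL : ∀ z ∈ U, ‖h z‖ < L := fun z hz => by
    obtain ⟨w, hw, hwL⟩ := hg z hz
    rwa [OnePoint.coe_injective ((hgh z hz).symm.trans hw)]
  have hlam : ∀ z ∈ U, T.lam z = (1 + ‖h z‖ ^ 2) ^ ((m : ℝ) / 2) * ‖T.f z‖ :=
    fun z hz => T.lam_eq z hz _ (hgh z hz)
  have hf0 : ∀ z ∈ U, T.f z ≠ 0 := fun z hz h0 => by
    have := T.lam_pos z hz
    simp [hlam z hz, h0] at this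
  obtain ⟨G, hG0, hG⟩ := exists_flatChart_of_le_distToBdry T.isOpen T.f_holo hf0
    (C := (1 + L ^ 2) ^ ((m : ℝ) / 2)) (by positivity)
    (fun z hz => by
      rw [hlam z hz]
      gcongr
      exact (hhL z hz).le) hp hdist
  have h0R : (0 : ℂ) ∈ Metric.ball 0 R := Metric.mem_ball_self hR
  have hhd : HasDerivAt h (deriv h p) p :=
    (hh.differentiableAt (T.isOpen.mem_nhds hp)).hasDerivAt
  have hcomp : HasDerivAt (h ∘ G) (deriv h p * (T.f p)⁻¹) 0 := by
    have h1 := (hG 0 h0R).2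
    rw [hG0] at h1
    exact HasDerivAt.comp 0 (hG0 ▸ hhd) h1
  have hschwarz := Complex.norm_deriv_le_div_of_mapsTo_ball (f := h ∘ G) (R₂ := 2 * L)
    (hh.comp hG.differentiableOn fun w hw => (hG w hw).1) (fun w hw => by
      rw [Metric.mem_closedBall, dist_eq_norm]
      have := norm_sub_le (h (G w)) (h (G 0))
      simp only [Function.comp_apply]
      linarith [hhL _ (hG w hw).1, hhL _ (hG 0 h0R).1]) hR
  rw [hcomp.deriv, norm_mul, norm_inv, ← div_eq_mul_inv, le_div_iff₀ hR] at hschwarz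
  rw [T.sqrt_abs_curv hp, mul_assoc]
  refine mul_le_mul_of_nonneg_left (le_trans ?_ hschwarz) (Real.sqrt_nonneg _)
  gcongr
  · exact norm_pos_iff.2 (hf0 p hp)
  · rw [sphD_coe hhd (mem_of_superset (T.isOpen.mem_nhds hp) hgh), abs_of_nonneg (by positivity)]
    exact div_le_self (norm_nonneg _) (by nlinarith [sq_nonneg ‖h p‖])
  · rw [hlam p hp]
    exact le_mul_of_one_le_left (norm_nonneg _)
      (Real.one_le_rpow (by nlinarith [sq_nonneg ‖h p‖]) (by positivity))

/-- The curvature estimate for Weierstrass triples with `|g| < L`. -/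
lemma curvature_estimate_of_norm_lt (T : WeierstrassTriple m U) {L : ℝ}
    (hg : ∀ z ∈ U, ∃ w : ℂ, T.g z = w ∧ ‖w‖ < L) {p : ℂ} (hp : p ∈ U) :
    ENNReal.ofReal (Real.sqrt |T.curv p|) * distToBdry T.lam U p ≤
      ENNReal.ofReal ((1 + L ^ 2) ^ ((m : ℝ) / 2) * (Real.sqrt (2 * m) * (2 * L))) := by
  have hL : 0 < L := by
    obtain ⟨w, -, hw⟩ := hg p hp
    exact (norm_nonneg w).trans_lt hw
  set C : ℝ := (1 + L ^ 2) ^ ((m : ℝ) / 2) with hC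
  have hCpos : 0 < C := by positivity
  refine ENNReal.mul_le_of_forall_lt fun a ha b hb => ?_
  have hbtop : b ≠ ⊤ := hb.ne_top
  rcases eq_or_ne b 0 with rfl | hb0
  · simp
  have hbpos : 0 < b.toReal := ENNReal.toReal_pos hb0 hbtop
  have key := T.sqrt_abs_curv_mul_le hg hp (R := b.toReal / C) (by positivity) (by
    rw [← hC, mul_div_cancel₀ _ hCpos.ne', ENNReal.ofReal_toReal hbtop]
    exact hb.le)
  calc a * b ≤ ENNReal.ofReal (Real.sqrt |T.curv p|) * ENNReal.ofReal b.toReal := by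
        rw [ENNReal.ofReal_toReal hbtop]
        gcongr
    _ = ENNReal.ofReal (Real.sqrt |T.curv p| * b.toReal) :=
        (ENNReal.ofReal_mul (Real.sqrt_nonneg _)).symm
    _ ≤ _ := by
        refine ENNReal.ofReal_le_ofReal ?_
        rwa [← mul_div_assoc, div_le_iff₀ hCpos, mul_comm _ C] at key

lemma curv_eq_zero_of_constant (T : WeierstrassTriple m U)
    (hg : ∀ z ∈ U, ∀ w ∈ U, T.g z = T.g w) {p : ℂ} (hp : p ∈ U) : T.curv p = 0 := by
  have : sphD T.g p = 0 := sphD_of_eventually_eq <|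
    mem_of_superset (T.isOpen.mem_nhds hp) fun w hw => hg w hw p hp
  simp [curv, this]

end WeierstrassTriple


/-- For every `L > 0` and `m ≥ 1`, `P_L` is a compact property satisfying the
`m`-curvature estimate; in particular `|K(p)|^{1/2} ≤ C / d(p)` for every Weierstrass
`m`-triple with `|g| < L`. -/
theorem PL_satisfies_curvature_estimate (L : ℝ) (hL : 0 < L) (m : ℕ) (hm : 0 < m) :
    IsCompactProperty (PL L) ∧ SatisfiesCurvatureEstimate (PL L) m ∧
      ∃ C : ℝ, 0 < C ∧ ∀ (U : Set ℂ) (T : WeierstrassTriple m U),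
        (∀ z ∈ U, ∃ w : ℂ, T.g z = (w : OnePoint ℂ) ∧ ‖w‖ < L) →
        ∀ p ∈ U, ENNReal.ofReal (Real.sqrt |T.curv p|) * distToBdry T.lam U p
          ≤ ENNReal.ofReal C := by
  have hC : 0 < (1 + L ^ 2) ^ ((m : ℝ) / 2) * (Real.sqrt (2 * m) * (2 * L)) := by positivity
  refine ⟨isCompactProperty_PL hL, ⟨_, pow_pos hC 2, fun U T hT p hp => ?_⟩,
    ⟨_, hC, fun U T hg p hp => T.curvature_estimate_of_norm_lt hg hp⟩⟩
  rcases hT.2 with hg | hg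
  · have hsq : |T.curv p| = Real.sqrt |T.curv p| ^ 2 := (Real.sq_sqrt (abs_nonneg _)).symm
    rw [hsq, ENNReal.ofReal_pow (Real.sqrt_nonneg _), ENNReal.ofReal_pow hC.le, ← mul_pow]
    exact pow_le_pow_left' (T.curvature_estimate_of_norm_lt hg hp) 2
  · simp [T.curv_eq_zero_of_constant hg hp]

end
end
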